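/- arXiv:1911.01758 — 5 statements merged into one kernel-verified Lean document; each statement's English description precedes it below -/
import Mathlib

section
/- Let f: G' → G be a homomorphism of graphs G' and G, and let C, R ⊆ V(G) with C ∪ R = V(G). Assume that every edge of G incident to a vertex of R is the image under f of some edge of G', and that the restriction of f to f^{-1}(R) is an isomorphism onto the subgraph induced by R. If f^{-1}(C) is guardable relative to f^{-1}(R) in G', then C is guardable relative to R in G. -/
namespace CopsRobbers

variable {V : Type}

/-- In one move a player may stay still or move to an adjacent vertex. -/
def adjOrEq (G : SimpleGraph V) (u v : V) : Prop := u = v ∨ G.Adj u v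

/-- The trajectory of a single cop with initial position `c₀` and positional strategy
`σ` (reading her own position and the robber's position) against a robber trajectory `r`. -/
def copWalk (c₀ : V) (σ : V → V → V) (r : ℕ → V) : ℕ → V
  | 0 => c₀
  | n + 1 => σ (copWalk c₀ σ r n) (r n)

/-- `C` is guardable relative to `R` in the subgraph `H` of `G`: there is a strategy for
a single cop (moving in `G`) and a time `N` such that against every robber trajectory
moving along edges of `H`, if the robber has stayed in `R` up to some time `n ≥ N` and
then moves to a vertex of `C`, he is caught by the cop on the next move. -/
def GuardableRel (G H : SimpleGraph V) (C R : Set V) : Prop :=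
  ∃ (c₀ : V) (σ : V → V → V) (N : ℕ),
    (∀ c r, adjOrEq G c (σ c r)) ∧
    ∀ r : ℕ → V, (∀ n, adjOrEq H (r n) (r (n + 1))) →
      ∀ n, N ≤ n → (∀ m < n, r m ∈ R) → r n ∈ C →
        copWalk c₀ σ r (n + 1) = r n

theorem adjOrEq.map {V' : Type} {G' : SimpleGraph V'} {G : SimpleGraph V} (f : G' →g G)
    {u v : V'} (h : adjOrEq G' u v) : adjOrEq G (f u) (f v) :=
  h.imp (congrArg f) f.map_adj

theorem copWalk_congr (c₀ : V) (σ : V → V → V) {r s : ℕ → V} {n : ℕ}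
    (h : ∀ k < n, r k = s k) : copWalk c₀ σ r n = copWalk c₀ σ s n := by
  induction n with
  | zero => rfl
  | succ n ih =>
    simp only [copWalk]
    rw [ih fun k hk => h k (hk.trans n.lt_succ_self), h n n.lt_succ_self]

/-- The position with the cop at `c` and the robber at `r` can occur after `n` rounds in which
the robber moves along edges of `G` and stays in `R` before the last round. -/
def Reachable (G : SimpleGraph V) (R : Set V) (c₀ : V) (σ : V → V → V) (n : ℕ) (c r : V) :
    Prop :=
  ∃ ρ : ℕ → V, (∀ k, adjOrEq G (ρ k) (ρ (k + 1))) ∧ (∀ k < n, ρ k ∈ R) ∧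
    copWalk c₀ σ ρ n = c ∧ ρ n = r

theorem reachable_zero (G : SimpleGraph V) (R : Set V) (c₀ : V) (σ : V → V → V) (r : V) :
    Reachable G R c₀ σ 0 c₀ r :=
  ⟨fun _ => r, fun _ => Or.inl rfl, fun _ hk => absurd hk (Nat.not_lt_zero _), rfl, rfl⟩

theorem Reachable.step {G : SimpleGraph V} {R : Set V} {c₀ : V} {σ : V → V → V} {n : ℕ}
    {c r s : V} (h : Reachable G R c₀ σ n c r) (hr : r ∈ R) (hrs : adjOrEq G r s) :
    Reachable G R c₀ σ (n + 1) (σ c r) s := by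
  obtain ⟨ρ, hρ, hR, rfl, rfl⟩ := h
  refine ⟨fun k => if k ≤ n then ρ k else s, fun k => ?_, fun k hk => ?_, ?_, by simp⟩
  · rcases lt_trichotomy k n with hk | rfl | hk
    · simpa [hk.le, Nat.succ_le_of_lt hk] using hρ k
    · simpa using hrs
    · exact Or.inl (by simp [hk.not_ge, (hk.trans k.lt_succ_self).not_ge])
  · rcases Nat.lt_succ_iff_lt_or_eq.mp hk with hk | rfl
    · simpa [hk.le] using hR k hk
    · simpa using hr
  · simp only [copWalk, le_refl, if_true]
    rw [copWalk_congr c₀ σ fun k hk => if_pos (le_of_lt hk)]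

/-- A positional strategy for the image of a cop playing `σ` in `G'`: among all reachable
positions over the current one, imitate one for which the remaining time until `N` is least. -/
theorem exists_image_strategy {V' : Type} {G : SimpleGraph V} {G' : SimpleGraph V'}
    (f : G' →g G) (R' : Set V') (c₀ : V') (σ : V' → V' → V') (N : ℕ)
    (hσ : ∀ c r, adjOrEq G' c (σ c r)) :
    ∃ τ : V → V → V, (∀ c r, adjOrEq G c (τ c r)) ∧
      ∀ m c r, Reachable G' R' c₀ σ m c r →
        ∃ m₁ c₁ r₁, N - m₁ ≤ N - m ∧ Reachable G' R' c₀ σ m₁ c₁ r₁ ∧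
          f r₁ = f r ∧ τ (f c) (f r) = f (σ c₁ r₁) := by
  have key : ∀ c r : V, ∃ d, adjOrEq G c d ∧ ∀ m c₂ r₂, Reachable G' R' c₀ σ m c₂ r₂ →
      f c₂ = c → f r₂ = r → ∃ m₁ c₁ r₁, N - m₁ ≤ N - m ∧ Reachable G' R' c₀ σ m₁ c₁ r₁ ∧
        f r₁ = r ∧ d = f (σ c₁ r₁) := by
    intro c r
    let S : Set (ℕ × V' × V') :=
      {p | Reachable G' R' c₀ σ p.1 p.2.1 p.2.2 ∧ f p.2.1 = c ∧ f p.2.2 = r}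
    rcases S.eq_empty_or_nonempty with hS | hS
    · exact ⟨c, Or.inl rfl, fun m c₂ r₂ h hc hr =>
        absurd (show (m, c₂, r₂) ∈ S from ⟨h, hc, hr⟩) (hS ▸ Set.notMem_empty _)⟩
    · obtain ⟨⟨m₁, c₁, r₁⟩, ⟨h₁, hc₁, hr₁⟩, hmin⟩ :=
        (measure fun p : ℕ × V' × V' => N - p.1).wf.has_min S hS
      exact ⟨f (σ c₁ r₁), hc₁ ▸ (hσ c₁ r₁).map f, fun m c₂ r₂ h hc hr =>
        ⟨m₁, c₁, r₁, not_lt.mp (hmin (m, c₂, r₂) ⟨h, hc, hr⟩), h₁, hr₁, rfl⟩⟩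
  choose τ hτ h using key
  exact ⟨τ, hτ, fun m c r hm => h _ _ m c r hm rfl rfl⟩

/-- Lemma (relative guarding): if `f : G' → G` is a graph homomorphism, `C ∪ R = V(G)`,
every edge incident to `R` is the image of an edge of `G'`, and `f` restricts to an
isomorphism from the subgraph induced by `f⁻¹(R)` onto the subgraph induced by `R`, then
guardability of `f⁻¹(C)` relative to `f⁻¹(R)` in `G'` implies guardability of `C`
relative to `R` in `G`. -/
theorem stmt6 {V V' : Type} (G : SimpleGraph V) (G' : SimpleGraph V')
    (f : G' →g G) (C R : Set V)
    (hCR : C ∪ R = Set.univ)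
    (hedge : ∀ u v : V, G.Adj u v → (u ∈ R ∨ v ∈ R) →
      ∃ u' v' : V', G'.Adj u' v' ∧ f u' = u ∧ f v' = v)
    (hbij : Set.BijOn f (f ⁻¹' R) R)
    (hiso : ∀ u' v' : V', f u' ∈ R → f v' ∈ R → (G'.Adj u' v' ↔ G.Adj (f u') (f v')))
    (hguard : GuardableRel G' G' (⇑f ⁻¹' C) (⇑f ⁻¹' R)) :
    GuardableRel G G C R := by
  obtain ⟨c₀, σ, N, hσ, hcatch⟩ := hguard
  obtain ⟨τ, hτ, himage⟩ := exists_image_strategy f (f ⁻¹' R) c₀ σ N hσ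
  have hlift : ∀ (r' : V') (s : V), f r' ∈ R → adjOrEq G (f r') s →
      ∃ s', adjOrEq G' r' s' ∧ f s' = s := by
    rintro r' s hr (rfl | hadj)
    · exact ⟨r', Or.inl rfl, rfl⟩
    · obtain ⟨u', v', huv, hu, hv⟩ := hedge _ _ hadj (Or.inl hr)
      obtain rfl : u' = r' := hbij.injOn (show f u' ∈ R from hu ▸ hr) hr hu
      exact ⟨v', Or.inr huv, hv⟩
  refine ⟨f c₀, τ, N + 1, hτ, fun r hr n hn hR hC => ?_⟩
  have hinv : ∀ k ≤ n, ∃ m c' r', N - m ≤ N - k ∧ Reachable G' (f ⁻¹' R) c₀ σ m c' r' ∧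
      f c' = copWalk (f c₀) τ r k ∧ f r' = r k := by
    intro k
    induction k with
    | zero =>
      intro _
      obtain ⟨r', -, hr'⟩ := hbij.surjOn (hR 0 (by omega))
      exact ⟨0, c₀, r', le_rfl, reachable_zero .., rfl, hr'⟩
    | succ k ih =>
      intro hk
      obtain ⟨m, c', r', hm, hreach, hc', hr'⟩ := ih (by omega)
      obtain ⟨m₁, c₁, r₁, hm₁, hreach₁, hr₁, hτ₁⟩ := himage m c' r' hreach
      have hr₁R : f r₁ ∈ R := by
        rw [hr₁, hr']
        exact hR k hk
      obtain ⟨s', hs', hfs'⟩ := hlift r₁ (r (k + 1)) hr₁R (by rw [hr₁, hr']; exact hr k)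
      exact ⟨m₁ + 1, σ c₁ r₁, s', by omega, hreach₁.step hr₁R hs',
        by rw [← hτ₁, hc', hr', copWalk], hfs'⟩
  obtain ⟨m, c', r', hm, hreach, hc', hr'⟩ := hinv n le_rfl
  obtain ⟨m₁, c₁, r₁, hm₁, ⟨ρ, hρ, hρR, rfl, rfl⟩, hr₁, hτ₁⟩ := himage m c' r' hreach
  have hρC : f (ρ m₁) ∈ C := by
    rw [hr₁, hr']
    exact hC
  have hcaught := hcatch ρ hρ m₁ (by omega) hρR hρC
  rw [copWalk] at hcaught ⊢
  rw [← hc', ← hr', hτ₁, hcaught, hr₁]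

end CopsRobbers
end

section
/- If Marker has a strategy in the combinatorial Marker-Cutter game against restricted Cutter limiting the value of each game state to t, then Marker also has a strategy against (unrestricted) combinatorial Cutter limiting the value of each game state to t. -/
open scoped Classical

namespace MarkerCutter

/-- Labels for the edges of boundary cycles. -/
abbrev Label := ℕ

/-- A boundary cycle is recorded by the list of its edge labels in cyclic order
(an arbitrary linearisation of the cyclic word; the vertices of the cycle are the
positions between consecutive letters). -/
abbrev Word := List Label

/-- A set of boundary cycles: a multiset of cycles, each a nonempty cyclic word. -/
abbrev Config := Multiset Word

/-- A game state of the combinatorial Marker-Cutter game: a set of labelled boundary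
cycles together with the genus counter. -/
abbrev GState := Config × ℕ

/-- The multiset of all labels appearing on edges (with multiplicity). -/
def allLabels (D : Config) : Multiset Label := D.bind fun w => (w : Multiset Label)

/-- A game state is proper if no component is an isolated vertex and every label
appears on at most two edges. -/
def ProperState (γ : GState) : Prop :=
  ([] : Word) ∉ γ.1 ∧ ∀ a : Label, (allLabels γ.1).count a ≤ 2

/-- The value of a game state: the number of distinct labels appearing on edges. -/
noncomputable def gvalue (γ : GState) : ℕ := (allLabels γ.1).toFinset.card

/-- `w` is a linearisation of the cyclic word `c` read from some other starting vertex. -/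
def IsRotationOf (c w : Word) : Prop := ∃ n : ℕ, w = c.rotate n

/-- A label appearing on exactly one edge. -/
def UniquelyAppearing (D : Config) (a : Label) : Prop := (allLabels D).count a = 1

/-- A label appearing on only one cycle. -/
def IsolatedLabel (D : Config) (a : Label) : Prop := Multiset.countP (fun w => a ∈ w) D ≤ 1

/-- A move of Marker: either two (not necessarily distinct) vertices on a common cycle,
specified by the two segments `P`, `P'` of the cycle between them (with `P = P' = []`
encoding a single dummy vertex chosen twice), or two vertices in different components,
specified by the linearisations `w₁`, `w₂` of the two cycles read from the chosen
vertices (with `[]` encoding a dummy vertex). -/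
inductive MChoice : Type
  | same (P P' : Word)
  | diff (w₁ w₂ : Word)

/-- Validity of a Marker move with respect to the current set of boundary cycles. -/
def MValid (D : Config) : MChoice → Prop
  | .same P P' => (P = [] ∧ P' = []) ∨ ∃ c ∈ D, IsRotationOf c (P ++ P')
  | .diff w₁ w₂ =>
      (w₁ = [] ∧ w₂ = []) ∨
      (w₁ = [] ∧ w₂ ≠ [] ∧ ∃ c ∈ D, IsRotationOf c w₂) ∨
      (w₂ = [] ∧ w₁ ≠ [] ∧ ∃ c ∈ D, IsRotationOf c w₁) ∨
      (w₁ ≠ [] ∧ w₂ ≠ [] ∧ ∃ (D₀ : Config) (c₁ c₂ : Word),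
        D = c₁ ::ₘ c₂ ::ₘ D₀ ∧ IsRotationOf c₁ w₁ ∧ IsRotationOf c₂ w₂)

/-- Cutter's legal responses in the (unrestricted) combinatorial Marker-Cutter game:
moves of type (a), (b), (c) for a `same` choice (keeping an arbitrary union `Dkeep` of the
remaining components and an arbitrary `g' ≤ g` for (b), (c)), and the forced move of
type (d) for a `diff` choice.  The two new edges receive a common fresh label `ℓ`. -/
def CutterResp (γ : GState) (m : MChoice) (γ' : GState) : Prop :=
  ∃ ℓ : Label, ℓ ∉ allLabels γ.1 ∧
    match m with
    | .same P P' =>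
        ∃ Drest : Config,
          ((P = [] ∧ P' = [] ∧ Drest = γ.1) ∨
            (∃ c, γ.1 = c ::ₘ Drest ∧ IsRotationOf c (P ++ P'))) ∧
          ((1 ≤ γ.2 ∧ ∃ Dkeep ≤ Drest,
              γ' = ((P ++ [ℓ]) ::ₘ (P' ++ [ℓ]) ::ₘ Dkeep, γ.2 - 1)) ∨
           (∃ Dkeep ≤ Drest, ∃ g' ≤ γ.2, γ' = ((P ++ [ℓ]) ::ₘ Dkeep, g')) ∨
           (∃ Dkeep ≤ Drest, ∃ g' ≤ γ.2, γ' = ((P' ++ [ℓ]) ::ₘ Dkeep, g')))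
    | .diff w₁ w₂ =>
        ∃ Drest : Config,
          ((w₁ = [] ∧ w₂ = [] ∧ Drest = γ.1) ∨
           (w₁ = [] ∧ w₂ ≠ [] ∧ ∃ c, γ.1 = c ::ₘ Drest ∧ IsRotationOf c w₂) ∨
           (w₂ = [] ∧ w₁ ≠ [] ∧ ∃ c, γ.1 = c ::ₘ Drest ∧ IsRotationOf c w₁) ∨
           (w₁ ≠ [] ∧ w₂ ≠ [] ∧ ∃ c₁ c₂, γ.1 = c₁ ::ₘ c₂ ::ₘ Drest ∧
              IsRotationOf c₁ w₁ ∧ IsRotationOf c₂ w₂)) ∧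
          γ' = ((w₁ ++ [ℓ] ++ w₂ ++ [ℓ]) ::ₘ Drest, γ.2)

/-- The result of a move of type (a) by restricted Cutter (who keeps all other
components and decrements the counter). -/
def RMoveA (γ : GState) (P P' : Word) (γ' : GState) : Prop :=
  ∃ ℓ : Label, ℓ ∉ allLabels γ.1 ∧
    ∃ Drest : Config,
      ((P = [] ∧ P' = [] ∧ Drest = γ.1) ∨
        (∃ c, γ.1 = c ::ₘ Drest ∧ IsRotationOf c (P ++ P'))) ∧
      1 ≤ γ.2 ∧ γ' = ((P ++ [ℓ]) ::ₘ (P' ++ [ℓ]) ::ₘ Drest, γ.2 - 1)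

/-- The result of a move of type (b) by restricted Cutter. -/
def RMoveB (γ : GState) (P P' : Word) (γ' : GState) : Prop :=
  ∃ ℓ : Label, ℓ ∉ allLabels γ.1 ∧
    ∃ Drest : Config,
      ((P = [] ∧ P' = [] ∧ Drest = γ.1) ∨
        (∃ c, γ.1 = c ::ₘ Drest ∧ IsRotationOf c (P ++ P'))) ∧
      γ' = ((P ++ [ℓ]) ::ₘ Drest, γ.2)

/-- The result of a move of type (c) by restricted Cutter. -/
def RMoveC (γ : GState) (P P' : Word) (γ' : GState) : Prop :=
  RMoveB γ P' P γ'

/-- Restricted Cutter's responses: as Cutter's, but in moves of type (a), (b), (c) he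
must keep all remaining components and the counter (except for the decrement in (a)). -/
def RCutterResp (γ : GState) (m : MChoice) (γ' : GState) : Prop :=
  match m with
  | .same P P' => RMoveA γ P P' γ' ∨ RMoveB γ P P' γ' ∨ RMoveC γ P P' γ'
  | .diff w₁ w₂ =>
      ∃ ℓ : Label, ℓ ∉ allLabels γ.1 ∧
        ∃ Drest : Config,
          ((w₁ = [] ∧ w₂ = [] ∧ Drest = γ.1) ∨
           (w₁ = [] ∧ w₂ ≠ [] ∧ ∃ c, γ.1 = c ::ₘ Drest ∧ IsRotationOf c w₂) ∨
           (w₂ = [] ∧ w₁ ≠ [] ∧ ∃ c, γ.1 = c ::ₘ Drest ∧ IsRotationOf c w₁) ∨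
           (w₁ ≠ [] ∧ w₂ ≠ [] ∧ ∃ c₁ c₂, γ.1 = c₁ ::ₘ c₂ ::ₘ Drest ∧
              IsRotationOf c₁ w₁ ∧ IsRotationOf c₂ w₂)) ∧
          γ' = ((w₁ ++ [ℓ] ++ w₂ ++ [ℓ]) ::ₘ Drest, γ.2)

/-- Contraction of a single edge of a set of boundary cycles (deleting the component if it
becomes an isolated vertex). -/
def ContractStep (D D' : Config) : Prop :=
  ∃ (D₀ : Config) (u v : Word) (a : Label),
    D = (u ++ a :: v) ::ₘ D₀ ∧
    ((u = [] ∧ v = [] ∧ D' = D₀) ∨ (u ++ v ≠ [] ∧ D' = (u ++ v) ::ₘ D₀))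

/-- `δ` is a reduction of `γ`: the counter does not increase and the boundary cycles of
`δ` are obtained from those of `γ` by a sequence of contractions. -/
def IsReductionOf (δ γ : GState) : Prop :=
  δ.2 ≤ γ.2 ∧ Relation.ReflTransGen ContractStep γ.1 δ.1

/-- Two game states are equivalent if they differ by a bijective relabelling
(and a change of linearisations of the cyclic words). -/
def EquivStates (γ δ : GState) : Prop :=
  γ.2 = δ.2 ∧ ∃ φ : Label → Label, Function.Bijective φ ∧
    Multiset.Rel (fun w w' => IsRotationOf (w.map φ) w') γ.1 δ.1

/-- `γ'` is equivalent to a reduction of `δ`. -/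
def IsEquivReductionOf (γ' δ : GState) : Prop :=
  ∃ ρ : GState, IsReductionOf ρ δ ∧ EquivStates γ' ρ

/-- A response `γ'` of restricted Cutter is legal with respect to a history `hist` of
earlier game states if it is a restricted response which is not equivalent to a
reduction of any earlier game state. -/
def RCLegal (hist : Set GState) (γ : GState) (m : MChoice) (γ' : GState) : Prop :=
  RCutterResp γ m γ' ∧ ∀ δ ∈ hist, ¬ IsEquivReductionOf γ' δ

end MarkerCutter

namespace MarkerCutter

/-- The potential of the edge at position `i` of the path (`cyc = false`) or cycle
(`cyc = true`) `w`: `3/2` if its label appears exactly once in the whole configuration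
(recorded by the multiset `total` of all labels), `3/4` if it is incident on `w` to
another edge with the same label, and `1/2` otherwise. -/
noncomputable def edgePot (total : Multiset Label) (w : Word) (cyc : Bool) (i : ℕ) : ℚ :=
  if total.count (w.getD i 0) = 1 then 3/2
  else if ∃ j < w.length, j ≠ i ∧ w.getD j 0 = w.getD i 0 ∧
      (j = i + 1 ∨ i = j + 1 ∨
        (cyc = true ∧ 2 ≤ w.length ∧ ((i = 0 ∧ j = w.length - 1) ∨ (j = 0 ∧ i = w.length - 1))))
    then 3/4 else 1/2

/-- The potential of a path (`cyc = false`) or cycle (`cyc = true`) `w`. -/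
noncomputable def wordPot (total : Multiset Label) (w : Word) (cyc : Bool) : ℚ :=
  -2 + ∑ i ∈ Finset.range w.length, edgePot total w cyc i

/-- The potential of a game state (with respect to the initial counter `g₀`):
`4(g₀ - g) - 3 v(γ)` plus the sum of the potentials of all components of positive
potential. -/
noncomputable def statePot (g₀ : ℕ) (γ : GState) : ℚ :=
  4 * ((g₀ : ℚ) - (γ.2 : ℚ)) - 3 * (gvalue γ : ℚ) +
    (γ.1.map fun w => max (wordPot (allLabels γ.1) w true) 0).sum

/-- Nesting paths (recorded by their lists of labels): a single edge with a uniquely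
appearing label, or a path with non-isolated labels `(x, y, z)` such that `x` and `z`
also occur on a cycle with labels `(x, t, z, t)`, and `y` also occurs on a cycle
consisting of an edge labelled `y` together with a nesting path. -/
inductive IsNestingPath (D : Config) : Word → Prop
  | single (a : Label) : UniquelyAppearing D a → IsNestingPath D [a]
  | nest (x y z t : Label) (Q : Word) :
      ¬ IsolatedLabel D x → ¬ IsolatedLabel D y → ¬ IsolatedLabel D z →
      (∃ c ∈ D, IsRotationOf c [x, t, z, t]) →
      (∃ c ∈ D, IsRotationOf c (y :: Q)) →
      IsNestingPath D Q →
      IsNestingPath D [x, y, z]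

/-- A strategy for Marker: a move for every finite history of game states. -/
abbrev MStrategy := (n : ℕ) → (Fin (n + 1) → GState) → MChoice

/-- One round against (unrestricted) Cutter: Marker's choice is valid and Cutter
responds legally (the history is irrelevant). -/
def URespond (_hist : Set GState) (γ : GState) (m : MChoice) (γ' : GState) : Prop :=
  MValid γ.1 m ∧ CutterResp γ m γ'

/-- One round against restricted Cutter: Marker's choice is valid and restricted Cutter
responds with a legal restricted move with respect to the history. -/
def RRespond (hist : Set GState) (γ : GState) (m : MChoice) (γ' : GState) : Prop :=
  MValid γ.1 m ∧ RCLegal hist γ m γ'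

/-- The set of game states occurring in the play up to time `k`. -/
def histSet (play : ℕ → GState) (k : ℕ) : Set GState := {δ | ∃ j ≤ k, play j = δ}

/-- Marker's strategy `σ` limits the value of every game state to `t` in the game with
initial counter `g₀` against a Cutter with response relation `Resp`: along every play
consistent with `σ`, Marker's prescribed choice is always valid and the value of every
game state reached is at most `t`. -/
def MarkerLimits (Resp : Set GState → GState → MChoice → GState → Prop)
    (σ : MStrategy) (g₀ t : ℕ) : Prop :=
  ∀ (n : ℕ) (play : ℕ → GState), play 0 = (0, g₀) →
    (∀ k < n, Resp (histSet play k) (play k)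
      (σ k fun j => play ↑j) (play (k + 1))) →
    MValid (play n).1 (σ n fun j => play ↑j) ∧ gvalue (play n) ≤ t

/-- A strategy for Cutter: a response for every finite history of game states and
valid Marker move. -/
abbrev CStrategy := (n : ℕ) → (Fin (n + 1) → GState) → MChoice → GState

/-- A play consistent with a strategy `τ` of restricted Cutter: at every turn Marker
makes a valid move; if a legal restricted response exists Cutter answers according to
`τ`, and otherwise the game has ended (the state is repeated forever). -/
def RConsistentPlay (τ : CStrategy) (g₀ : ℕ) (play : ℕ → GState) (mk : ℕ → MChoice) : Prop :=
  play 0 = (0, g₀) ∧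
  ∀ k, MValid (play k).1 (mk k) ∧
    ((∃ γ', RRespond (histSet play k) (play k) (mk k) γ') →
      play (k + 1) = τ k (fun j => play ↑j) (mk k)) ∧
    ((¬ ∃ γ', RRespond (histSet play k) (play k) (mk k) γ') → play (k + 1) = play k)

end MarkerCutter

namespace MarkerCutter

/-- Every sublist of a cyclic word can be read off along any other linearisation. -/
theorem exists_isRotated_sublist {a b b' : Word} (h : a.Sublist b) (hb : b ~r b') :
    ∃ a', a' ~r a ∧ a'.Sublist b' := by
  obtain ⟨n, hn, rfl⟩ := List.isRotated_iff_mod.1 hb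
  rw [List.rotate_eq_drop_append_take hn]
  rw [← List.take_append_drop n b, List.sublist_append_iff] at h
  obtain ⟨x, y, rfl, hx, hy⟩ := h
  exact ⟨y ++ x, List.isRotated_append, hy.append hx⟩

theorem isRotationOf_iff {c w : Word} : IsRotationOf c w ↔ c ~r w :=
  ⟨fun ⟨n, h⟩ => ⟨n, h.symm⟩, fun ⟨n, h⟩ => ⟨n, h.symm⟩⟩

/-- After relabelling by `ψ`, the cycle `w` contracts to the cycle `w'`. -/
def CycleEmbeds (ψ : Label → Label) (w' w : Word) : Prop :=
  ∃ q, q ~r w' ∧ q.Sublist (w.map ψ)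

theorem CycleEmbeds.trans {φ ψ : Label → Label} {w'' w' w : Word}
    (h₁ : CycleEmbeds φ w'' w') (h₂ : CycleEmbeds ψ w' w) : CycleEmbeds (φ ∘ ψ) w'' w := by
  obtain ⟨q, hq, hs⟩ := h₁
  obtain ⟨q', hq', hs'⟩ := h₂
  obtain ⟨r, hr, hrs⟩ := exists_isRotated_sublist hs (hq'.symm.map φ)
  refine ⟨r, hr.trans hq, hrs.trans ?_⟩
  simpa using hs'.map φ

theorem CycleEmbeds.of_sublist {ψ : Label → Label} {w' w : Word}
    (h : w'.Sublist (w.map ψ)) : CycleEmbeds ψ w' w := ⟨w', .refl _, h⟩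

/-- After relabelling by `ψ`, some of the cycles of `D` contract to the cycles of `D'`. -/
def Embeds (ψ : Label → Label) (D' D : Config) : Prop :=
  ∃ K ≤ D, Multiset.Rel (CycleEmbeds ψ) D' K

theorem rel_comp {r s p : Word → Word → Prop} (h : ∀ a b c, r a b → s b c → p a c)
    {A B C : Config} (hr : Multiset.Rel r A B) (hs : Multiset.Rel s B C) :
    Multiset.Rel p A C := by
  induction hr generalizing C with
  | zero => rw [Multiset.rel_zero_left.1 hs]; exact .zero
  | cons hab _ ih =>
    obtain ⟨c, C', hc, hC, rfl⟩ := Multiset.rel_cons_left.1 hs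
    exact .cons (h _ _ _ hab hc) (ih hC)

theorem Embeds.refl (D : Config) : Embeds id D D :=
  ⟨D, le_rfl, Multiset.rel_refl_of_refl_on fun w _ => .of_sublist (by simp)⟩

theorem Embeds.mono_right {ψ : Label → Label} {D' D E : Config} (h : Embeds ψ D' D)
    (hE : D ≤ E) : Embeds ψ D' E := by
  obtain ⟨K, hK, hr⟩ := h
  exact ⟨K, hK.trans hE, hr⟩

theorem Embeds.mono_left {ψ : Label → Label} {D' D E : Config} (h : Embeds ψ D' D)
    (hE : E ≤ D') : Embeds ψ E D := by
  obtain ⟨K, hK, hr⟩ := h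
  obtain ⟨F, rfl⟩ := Multiset.le_iff_exists_add.1 hE
  obtain ⟨K₁, K₂, h₁, -, rfl⟩ := Multiset.rel_add_left.1 hr
  exact ⟨K₁, (Multiset.le_add_right _ _).trans hK, h₁⟩

theorem Embeds.cons {ψ : Label → Label} {D' D : Config} {w' w : Word} (h : Embeds ψ D' D)
    (hw : CycleEmbeds ψ w' w) : Embeds ψ (w' ::ₘ D') (w ::ₘ D) := by
  obtain ⟨K, hK, hr⟩ := h
  exact ⟨w ::ₘ K, Multiset.cons_le_cons _ hK, .cons hw hr⟩

theorem Embeds.trans {φ ψ : Label → Label} {D'' D' D : Config}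
    (h₁ : Embeds φ D'' D') (h₂ : Embeds ψ D' D) : Embeds (φ ∘ ψ) D'' D := by
  obtain ⟨K, hK, hr⟩ := h₁
  obtain ⟨L, hL, hs⟩ := h₂.mono_left hK
  exact ⟨L, hL, rel_comp (fun _ _ _ h h' => h.trans h') hr hs⟩

theorem Embeds.congr_left {ψ : Label → Label} {D' E D : Config} (h : Embeds ψ D' D)
    (hE : D'.map ((↑) : Word → Cycle Label) = E.map (↑)) : Embeds ψ E D := by
  obtain ⟨K, hK, hr⟩ := h
  refine ⟨K, hK, ?_⟩
  have : Multiset.Rel (fun a b : Word => (a : Cycle Label) = b) E D' := by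
    rw [← Multiset.rel_map, Multiset.rel_eq]; exact hE.symm
  refine rel_comp ?_ this hr
  rintro a b c hab ⟨q, hq, hs⟩
  exact ⟨q, hq.trans (Cycle.coe_eq_coe.1 hab).symm, hs⟩

theorem Embeds.congr_fun {φ ψ : Label → Label} {D' D : Config} (h : Embeds ψ D' D)
    (hφ : ∀ a ∈ allLabels D, φ a = ψ a) : Embeds φ D' D := by
  obtain ⟨K, hK, hr⟩ := h
  refine ⟨K, hK, hr.mono ?_⟩
  rintro w' - w hw ⟨q, hq, hs⟩
  refine ⟨q, hq, ?_⟩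
  rwa [List.map_congr_left fun a ha => hφ a ?_]
  exact Multiset.mem_bind.2 ⟨w, Multiset.mem_of_le hK hw, ha⟩

theorem Embeds.gvalue_le {ψ : Label → Label} {γ δ : GState} (h : Embeds ψ γ.1 δ.1) :
    gvalue γ ≤ gvalue δ := by
  obtain ⟨K, hK, hr⟩ := h
  refine (Finset.card_le_card ?_).trans (Finset.card_image_le (f := ψ))
  intro a ha
  simp only [Finset.mem_image, Multiset.mem_toFinset, allLabels, Multiset.mem_bind,
    Multiset.mem_coe] at ha ⊢
  obtain ⟨w', hw', ha⟩ := ha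
  obtain ⟨w, hw, q, hq, hs⟩ := Multiset.exists_mem_of_rel_of_mem hr hw'
  obtain ⟨b, hb, rfl⟩ := List.mem_map.1 (hs.subset (hq.mem_iff.2 ha))
  exact ⟨b, ⟨w, Multiset.mem_of_le hK hw, hb⟩, rfl⟩

theorem ContractStep.embeds {D D' : Config} (h : ContractStep D D') : Embeds id D' D := by
  obtain ⟨D₀, u, v, a, rfl, ⟨-, -, rfl⟩ | ⟨-, rfl⟩⟩ := h
  · exact (Embeds.refl _).mono_right (Multiset.le_cons_self _ _)
  · exact (Embeds.refl _).cons (.of_sublist (by simp))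

theorem IsEquivReductionOf.embeds {γ δ : GState} (h : IsEquivReductionOf γ δ) :
    γ.2 ≤ δ.2 ∧ ∃ ψ, Embeds ψ γ.1 δ.1 := by
  obtain ⟨ρ, ⟨hg, hρ⟩, hg', φ, hφ, hr⟩ := h
  have hρδ : Embeds id ρ.1 δ.1 := by
    generalize ρ.1 = E at hρ
    induction hρ with
    | refl => exact Embeds.refl _
    | tail _ hs ih => exact hs.embeds.trans ih
  obtain ⟨ψ, hψ, -⟩ := Function.bijective_iff_has_inverse.1 hφ
  have hγρ : Embeds ψ γ.1 ρ.1 := by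
    refine ⟨ρ.1, le_rfl, hr.mono ?_⟩
    intro w' _ w _ hw
    have := (isRotationOf_iff.1 hw).map ψ
    rw [List.map_map, hψ.comp_eq_id, List.map_id] at this
    exact ⟨_, this.symm, .refl _⟩
  exact ⟨hg'.trans_le hg, _, hγρ.trans hρδ⟩

/-- `E` is left over when the cycle linearised as `w` is removed from `D`, the empty
word standing for a dummy vertex. -/
def Take (D : Config) (w : Word) (E : Config) : Prop :=
  (w = [] ∧ E = D) ∨ (w ≠ [] ∧ ∃ c, D = c ::ₘ E ∧ IsRotationOf c w)

theorem Take.le {D E : Config} {w : Word} (h : Take D w E) : E ≤ D := by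
  obtain ⟨-, rfl⟩ | ⟨-, c, rfl, -⟩ := h
  · exact le_rfl
  · exact Multiset.le_cons_self _ _

theorem Take.map_cycle_eq {D D' E E' : Config} {w : Word} (h : Take D w E) (h' : Take D' w E')
    (hD : D.map ((↑) : Word → Cycle Label) = D'.map (↑)) :
    E.map ((↑) : Word → Cycle Label) = E'.map (↑) := by
  obtain ⟨rfl, rfl⟩ | ⟨hw, c, rfl, hc⟩ := h <;> obtain ⟨hw', rfl⟩ | ⟨hw', c', rfl, hc'⟩ := h'
  · exact hD
  · exact absurd rfl hw'
  · exact absurd hw' hw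
  · rw [Multiset.map_cons, Multiset.map_cons, Cycle.coe_eq_coe.2 (isRotationOf_iff.1 hc),
      Cycle.coe_eq_coe.2 (isRotationOf_iff.1 hc')] at hD
    exact (Multiset.cons_inj_right _).1 hD

theorem Take.exists_of_embeds {ψ : Label → Label} {D R S : Config} {w : Word}
    (hD : [] ∉ D) (h : Embeds ψ D R) (ht : Take R w S) :
    ∃ q E, q.Sublist (w.map ψ) ∧ Take D q E ∧ Embeds ψ E S := by
  obtain ⟨rfl, rfl⟩ | ⟨-, c, rfl, hc⟩ := ht
  · exact ⟨[], D, by simp, .inl ⟨rfl, rfl⟩, h⟩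
  obtain ⟨K, hK, hr⟩ := h
  by_cases hcK : c ∈ K
  · obtain ⟨L, rfl⟩ := Multiset.exists_cons_of_mem hcK
    obtain ⟨w', E, ⟨p, hp, hs⟩, hE, rfl⟩ := Multiset.rel_cons_right.1 hr
    obtain ⟨q, hq, hqs⟩ := exists_isRotated_sublist hs ((isRotationOf_iff.1 hc).map ψ)
    refine ⟨q, E, hqs, .inr ⟨?_, w', rfl, isRotationOf_iff.2 (hq.trans hp).symm⟩,
      L, (Multiset.cons_le_cons_iff _).1 hK, hE⟩
    rintro rfl
    obtain rfl := List.isRotated_nil_iff'.1 (hq.trans hp)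
    exact hD (Multiset.mem_cons_self _ _)
  · exact ⟨[], D, by simp, .inl ⟨rfl, rfl⟩, K, (Multiset.le_cons_of_notMem hcK).1 hK, hr⟩

theorem take_append_iff {D E : Config} {P P' : Word} (hD : [] ∉ D) :
    ((P = [] ∧ P' = [] ∧ E = D) ∨ ∃ c, D = c ::ₘ E ∧ IsRotationOf c (P ++ P')) ↔
      Take D (P ++ P') E := by
  constructor
  · rintro (⟨rfl, rfl, rfl⟩ | ⟨c, rfl, hc⟩)
    · exact .inl ⟨rfl, rfl⟩
    · refine .inr ⟨?_, c, rfl, hc⟩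
      intro h
      rw [h, isRotationOf_iff, List.isRotated_nil_iff] at hc
      exact hD (hc ▸ Multiset.mem_cons_self _ _)
  · rintro (⟨h, rfl⟩ | ⟨-, h⟩)
    · obtain ⟨rfl, rfl⟩ := List.append_eq_nil_iff.1 h
      exact .inl ⟨rfl, rfl, rfl⟩
    · exact .inr h

theorem take_take_iff {D E : Config} {w₁ w₂ : Word} :
    ((w₁ = [] ∧ w₂ = [] ∧ E = D) ∨
      (w₁ = [] ∧ w₂ ≠ [] ∧ ∃ c, D = c ::ₘ E ∧ IsRotationOf c w₂) ∨
      (w₂ = [] ∧ w₁ ≠ [] ∧ ∃ c, D = c ::ₘ E ∧ IsRotationOf c w₁) ∨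
      (w₁ ≠ [] ∧ w₂ ≠ [] ∧ ∃ c₁ c₂, D = c₁ ::ₘ c₂ ::ₘ E ∧
        IsRotationOf c₁ w₁ ∧ IsRotationOf c₂ w₂)) ↔
      ∃ F, Take D w₁ F ∧ Take F w₂ E := by
  constructor
  · rintro (⟨rfl, rfl, rfl⟩ | ⟨rfl, h, h'⟩ | ⟨rfl, h, h'⟩ | ⟨h₁, h₂, c₁, c₂, rfl, hc₁, hc₂⟩)
    · exact ⟨E, .inl ⟨rfl, rfl⟩, .inl ⟨rfl, rfl⟩⟩
    · exact ⟨D, .inl ⟨rfl, rfl⟩, .inr ⟨h, h'⟩⟩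
    · exact ⟨E, .inr ⟨h, h'⟩, .inl ⟨rfl, rfl⟩⟩
    · exact ⟨_, .inr ⟨h₁, c₁, rfl, hc₁⟩, .inr ⟨h₂, c₂, rfl, hc₂⟩⟩
  · rintro ⟨F, ⟨rfl, rfl⟩ | ⟨h₁, c₁, rfl, hc₁⟩, ⟨rfl, rfl⟩ | ⟨h₂, c₂, rfl, hc₂⟩⟩
    · exact .inl ⟨rfl, rfl, rfl⟩
    · exact .inr (.inl ⟨rfl, h₂, c₂, rfl, hc₂⟩)
    · exact .inr (.inr (.inl ⟨rfl, h₁, c₁, rfl, hc₁⟩))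
    · exact .inr (.inr (.inr ⟨h₁, h₂, c₁, c₂, rfl, hc₁, hc₂⟩))

theorem mValid_same_iff {D : Config} {P P' : Word} (hD : [] ∉ D) :
    MValid D (.same P P') ↔ ∃ E, Take D (P ++ P') E := by
  simp only [← take_append_iff hD, MValid]
  constructor
  · rintro (⟨h, h'⟩ | ⟨c, hc, h⟩)
    · exact ⟨D, .inl ⟨h, h', rfl⟩⟩
    · obtain ⟨E, rfl⟩ := Multiset.exists_cons_of_mem hc
      exact ⟨E, .inr ⟨c, rfl, h⟩⟩
  · rintro ⟨E, ⟨h, h', -⟩ | ⟨c, rfl, h⟩⟩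
    · exact .inl ⟨h, h'⟩
    · exact .inr ⟨c, Multiset.mem_cons_self _ _, h⟩

theorem mValid_diff_iff {D : Config} {w₁ w₂ : Word} :
    MValid D (.diff w₁ w₂) ↔ ∃ E F, Take D w₁ F ∧ Take F w₂ E := by
  simp only [← take_take_iff, MValid]
  constructor
  · rintro (⟨h, h'⟩ | ⟨h, h', c, hc, hr⟩ | ⟨h, h', c, hc, hr⟩ | ⟨h, h', E, c₁, c₂, hc⟩)
    · exact ⟨D, .inl ⟨h, h', rfl⟩⟩
    · obtain ⟨E, rfl⟩ := Multiset.exists_cons_of_mem hc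
      exact ⟨E, .inr (.inl ⟨h, h', c, rfl, hr⟩)⟩
    · obtain ⟨E, rfl⟩ := Multiset.exists_cons_of_mem hc
      exact ⟨E, .inr (.inr (.inl ⟨h, h', c, rfl, hr⟩))⟩
    · exact ⟨E, .inr (.inr (.inr ⟨h, h', c₁, c₂, hc⟩))⟩
  · rintro ⟨E, ⟨h, h', -⟩ | ⟨h, h', c, rfl, hr⟩ | ⟨h, h', c, rfl, hr⟩ | ⟨h, h', c₁, c₂, hc⟩⟩
    · exact .inl ⟨h, h'⟩
    · exact .inr (.inl ⟨h, h', c, Multiset.mem_cons_self _ _, hr⟩)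
    · exact .inr (.inr (.inl ⟨h, h', c, Multiset.mem_cons_self _ _, hr⟩))
    · exact .inr (.inr (.inr ⟨h, h', E, c₁, c₂, hc⟩))

theorem CutterResp.nil_notMem {γ γ' : GState} {m : MChoice} (hγ : [] ∉ γ.1)
    (h : CutterResp γ m γ') : [] ∉ γ'.1 := by
  obtain ⟨ℓ, -, h⟩ := h
  cases m with
  | same P P' =>
    obtain ⟨E, hE, h⟩ := h
    have hE' : [] ∉ E := fun h' => hγ (Multiset.mem_of_le ((take_append_iff hγ).1 hE).le h')
    obtain ⟨-, K, hK, rfl⟩ | ⟨K, hK, g', -, rfl⟩ | ⟨K, hK, g', -, rfl⟩ := h <;>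
      simpa using fun h' => hE' (Multiset.mem_of_le hK h')
  | diff w₁ w₂ =>
    obtain ⟨E, hE, rfl⟩ := h
    obtain ⟨F, h₁, h₂⟩ := take_take_iff.1 hE
    simpa using fun h' => hγ (Multiset.mem_of_le (h₂.le.trans h₁.le) h')

theorem sublist_map_update {ψ : Label → Label} {q w : Word} {ℓ ℓ' : Label}
    (h : q.Sublist (w.map ψ)) (hw : ℓ' ∉ w) :
    q.Sublist (w.map (Function.update ψ ℓ' ℓ)) := by
  rwa [List.map_congr_left fun a ha =>
    Function.update_of_ne (by rintro rfl; exact hw ha) ℓ ψ]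

theorem Take.notMem {D E : Config} {w : Word} {ℓ : Label} (h : Take D w E)
    (hℓ : ℓ ∉ allLabels D) : ℓ ∉ w := by
  obtain ⟨rfl, -⟩ | ⟨-, c, rfl, hc⟩ := h
  · simp
  · rw [← (isRotationOf_iff.1 hc).mem_iff]
    intro h'
    exact hℓ (Multiset.mem_bind.2 ⟨c, Multiset.mem_cons_self _ _, h'⟩)

theorem notMem_allLabels_of_le {D E : Config} {ℓ : Label} (h : E ≤ D)
    (hℓ : ℓ ∉ allLabels D) : ℓ ∉ allLabels E := by
  intro h'
  obtain ⟨w, hw, hm⟩ := Multiset.mem_bind.1 h'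
  exact hℓ (Multiset.mem_bind.2 ⟨w, Multiset.mem_of_le h hw, hm⟩)

theorem Embeds.update {ψ : Label → Label} {D' D : Config} {ℓ ℓ' : Label} (h : Embeds ψ D' D)
    (hℓ : ℓ' ∉ allLabels D) : Embeds (Function.update ψ ℓ' ℓ) D' D :=
  h.congr_fun fun _ ha => Function.update_of_ne (by rintro rfl; exact hℓ ha) _ _

/-- A move of Marker can be transferred along an embedding so that every response of
Cutter is dominated by a response of restricted Cutter. -/
theorem exists_simulating_choice {γ δ : GState} {ψ : Label → Label} {m : MChoice}
    (hγ : [] ∉ γ.1) (hδ : [] ∉ δ.1) (hg : γ.2 ≤ δ.2) (hψ : Embeds ψ γ.1 δ.1)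
    (hm : MValid δ.1 m) :
    ∃ m', MValid γ.1 m' ∧ ∀ γ', CutterResp γ m' γ' →
      ∃ δ' φ, RCutterResp δ m δ' ∧ γ'.2 ≤ δ'.2 ∧ Embeds φ γ'.1 δ'.1 := by
  obtain ⟨ℓ', hℓ'⟩ := Infinite.exists_notMem_finset (allLabels δ.1).toFinset
  rw [Multiset.mem_toFinset] at hℓ'
  cases m with
  | same P P' =>
    obtain ⟨S, hS⟩ := (mValid_same_iff hδ).1 hm
    obtain ⟨q, E, hq, hE, hES⟩ := Take.exists_of_embeds hγ hψ hS
    rw [List.map_append, List.sublist_append_iff] at hq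
    obtain ⟨Q, Q', rfl, hQ, hQ'⟩ := hq
    refine ⟨.same Q Q', (mValid_same_iff hγ).2 ⟨E, hE⟩, ?_⟩
    rintro γ' ⟨ℓ, -, E', hE', h⟩
    rw [take_append_iff hγ] at hE'
    have hℓP := hS.notMem hℓ'
    rw [List.mem_append, not_or] at hℓP
    have hrest : ∀ K ≤ E', Embeds (Function.update ψ ℓ' ℓ) K S := fun K hK =>
      ((hES.congr_left (hE.map_cycle_eq hE' rfl)).mono_left hK).update
        (notMem_allLabels_of_le hS.le hℓ')
    have hP : CycleEmbeds (Function.update ψ ℓ' ℓ) (Q ++ [ℓ]) (P ++ [ℓ']) :=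
      .of_sublist (by simpa using sublist_map_update hQ hℓP.1)
    have hP' : CycleEmbeds (Function.update ψ ℓ' ℓ) (Q' ++ [ℓ]) (P' ++ [ℓ']) :=
      .of_sublist (by simpa using sublist_map_update hQ' hℓP.2)
    have hS₁ := (take_append_iff hδ).2 hS
    have hS₂ : (P' = [] ∧ P = [] ∧ S = δ.1) ∨
        ∃ c, δ.1 = c ::ₘ S ∧ IsRotationOf c (P' ++ P) := by
      obtain ⟨h, h', h''⟩ | ⟨c, hc, hr⟩ := hS₁
      · exact .inl ⟨h', h, h''⟩
      · exact .inr ⟨c, hc, isRotationOf_iff.2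
          ((isRotationOf_iff.1 hr).trans List.isRotated_append)⟩
    obtain ⟨h1, K, hK, rfl⟩ | ⟨K, hK, g', hg', rfl⟩ | ⟨K, hK, g', hg', rfl⟩ := h
    · exact ⟨_, _, .inl ⟨ℓ', hℓ', S, hS₁, h1.trans hg, rfl⟩, Nat.sub_le_sub_right hg 1,
        ((hrest K hK).cons hP').cons hP⟩
    · exact ⟨_, _, .inr (.inl ⟨ℓ', hℓ', S, hS₁, rfl⟩), hg'.trans hg, (hrest K hK).cons hP⟩
    · exact ⟨_, _, .inr (.inr ⟨ℓ', hℓ', S, hS₂, rfl⟩), hg'.trans hg, (hrest K hK).cons hP'⟩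
  | diff w₁ w₂ =>
    obtain ⟨S, T, hT, hS⟩ := mValid_diff_iff.1 hm
    obtain ⟨q₁, F, hq₁, hF, hFT⟩ := Take.exists_of_embeds hγ hψ hT
    obtain ⟨q₂, E, hq₂, hE, hES⟩ :=
      Take.exists_of_embeds (fun h => hγ (Multiset.mem_of_le hF.le h)) hFT hS
    refine ⟨.diff q₁ q₂, mValid_diff_iff.2 ⟨E, F, hF, hE⟩, ?_⟩
    rintro γ' ⟨ℓ, -, E', hE', rfl⟩
    obtain ⟨F', hF', hE'⟩ := take_take_iff.1 hE'
    have hℓT := notMem_allLabels_of_le hT.le hℓ'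
    have h₁ := sublist_map_update (ℓ := ℓ) hq₁ (hT.notMem hℓ')
    have h₂ := sublist_map_update (ℓ := ℓ) hq₂ (hS.notMem hℓT)
    refine ⟨_, Function.update ψ ℓ' ℓ, ⟨ℓ', hℓ', S, take_take_iff.2 ⟨T, hT, hS⟩, rfl⟩, hg, ?_⟩
    refine ((hES.congr_left (hE.map_cycle_eq hE' (hF.map_cycle_eq hF' rfl))).update
      (notMem_allLabels_of_le hS.le hℓT)).cons (.of_sublist ?_)
    simpa using h₁.append ((List.Sublist.refl [ℓ]).append (h₂.append (.refl [ℓ])))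

theorem RCutterResp.cutterResp {γ γ' : GState} {m : MChoice} (h : RCutterResp γ m γ') :
    CutterResp γ m γ' := by
  cases m with
  | diff w₁ w₂ => exact h
  | same P P' =>
    obtain ⟨ℓ, hℓ, S, hS, hg, rfl⟩ | ⟨ℓ, hℓ, S, hS, rfl⟩ | ⟨ℓ, hℓ, S, hS, rfl⟩ := h
    · exact ⟨ℓ, hℓ, S, hS, .inl ⟨hg, S, le_rfl, rfl⟩⟩
    · exact ⟨ℓ, hℓ, S, hS, .inr (.inl ⟨S, le_rfl, _, le_rfl, rfl⟩)⟩
    · refine ⟨ℓ, hℓ, S, ?_, .inr (.inr ⟨S, le_rfl, _, le_rfl, rfl⟩)⟩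
      obtain ⟨h, h', h''⟩ | ⟨c, hc, hr⟩ := hS
      · exact .inl ⟨h', h, h''⟩
      · exact .inr ⟨c, hc, isRotationOf_iff.2
          ((isRotationOf_iff.1 hr).trans List.isRotated_append)⟩

/-- `play` is, up to time `n`, a play of restricted Cutter against the strategy `σ`. -/
def RestrictedPlay (σ : MStrategy) (g₀ n : ℕ) (play : ℕ → GState) : Prop :=
  play 0 = (0, g₀) ∧ ∀ k < n, RRespond (histSet play k) (play k)
    (σ k fun j => play ↑j) (play (k + 1))

theorem RestrictedPlay.mono {σ : MStrategy} {g₀ n k : ℕ} {play : ℕ → GState}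
    (h : RestrictedPlay σ g₀ n play) (hk : k ≤ n) : RestrictedPlay σ g₀ k play :=
  ⟨h.1, fun j hj => h.2 j (hj.trans_le hk)⟩

theorem RestrictedPlay.nil_notMem {σ : MStrategy} {g₀ n : ℕ} {play : ℕ → GState}
    (h : RestrictedPlay σ g₀ n play) : [] ∉ (play n).1 := by
  induction n with
  | zero => simp [h.1]
  | succ n ih => exact (h.2 n n.lt_succ_self).2.1.cutterResp.nil_notMem (ih (h.mono n.le_succ))

theorem RestrictedPlay.extend {σ : MStrategy} {g₀ n : ℕ} {play : ℕ → GState} {δ : GState}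
    (h : RestrictedPlay σ g₀ n play)
    (hδ : RRespond (histSet play n) (play n) (σ n fun j => play ↑j) δ) :
    RestrictedPlay σ g₀ (n + 1) (Function.update play (n + 1) δ) := by
  have hne : ∀ k ≤ n, Function.update play (n + 1) δ k = play k := fun k hk =>
    Function.update_of_ne (by omega) _ _
  refine ⟨by rw [hne 0 n.zero_le, h.1], fun k hk => ?_⟩
  have hk' : k ≤ n := Nat.lt_succ_iff.1 hk
  have hhist : histSet (Function.update play (n + 1) δ) k = histSet play k := by
    ext ε
    constructor <;> rintro ⟨j, hj, rfl⟩
    · exact ⟨j, hj, (hne j (hj.trans hk')).symm⟩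
    · exact ⟨j, hj, hne j (hj.trans hk')⟩
  have hfun : (fun j : Fin (k + 1) => Function.update play (n + 1) δ ↑j) =
      fun j : Fin (k + 1) => play ↑j :=
    funext fun j => hne j ((Nat.lt_succ_iff.1 j.2).trans hk')
  rw [hhist, hfun, hne k hk']
  obtain rfl | hlt := hk'.eq_or_lt
  · rwa [Function.update_self]
  · rw [hne (k + 1) hlt]
    exact h.2 k hlt

/-- `γ` is dominated by a state that can occur in a restricted play against `σ`. -/
def Dominated (σ : MStrategy) (g₀ : ℕ) (γ : GState) : Prop :=
  [] ∉ γ.1 ∧ ∃ n play, RestrictedPlay σ g₀ n play ∧ γ.2 ≤ (play n).2 ∧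
    ∃ ψ, Embeds ψ γ.1 (play n).1

theorem Dominated.exists_choice {σ : MStrategy} {g₀ t : ℕ} (hσ : MarkerLimits RRespond σ g₀ t)
    {γ : GState} (h : Dominated σ g₀ γ) :
    ∃ m, MValid γ.1 m ∧ ∀ γ', CutterResp γ m γ' → Dominated σ g₀ γ' := by
  obtain ⟨hγ, n, play, hplay, hg, ψ, hψ⟩ := h
  have hvalid := (hσ n play hplay.1 hplay.2).1
  obtain ⟨m, hm, hresp⟩ := exists_simulating_choice hγ hplay.nil_notMem hg hψ hvalid
  refine ⟨m, hm, fun γ' h' => ⟨h'.nil_notMem hγ, ?_⟩⟩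
  obtain ⟨δ, φ, hδ, hg', hφ⟩ := hresp γ' h'
  by_cases hlegal : ∀ ε ∈ histSet play n, ¬ IsEquivReductionOf δ ε
  · exact ⟨n + 1, _, hplay.extend ⟨hvalid, hδ, hlegal⟩, by rwa [Function.update_self], φ,
      by rwa [Function.update_self]⟩
  · push Not at hlegal
    obtain ⟨_, ⟨j, hj, rfl⟩, hred⟩ := hlegal
    obtain ⟨hgj, χ, hχ⟩ := hred.embeds
    exact ⟨j, play, hplay.mono hj, hg'.trans hgj, _, hφ.trans hχ⟩

theorem Dominated.gvalue_le {σ : MStrategy} {g₀ t : ℕ} (hσ : MarkerLimits RRespond σ g₀ t)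
    {γ : GState} (h : Dominated σ g₀ γ) : gvalue γ ≤ t := by
  obtain ⟨-, n, play, hplay, -, ψ, hψ⟩ := h
  exact hψ.gvalue_le.trans (hσ n play hplay.1 hplay.2).2

theorem stmt12 (g₀ t : ℕ)
    (h : ∃ σ : MStrategy, MarkerLimits RRespond σ g₀ t) :
    ∃ σ : MStrategy, MarkerLimits URespond σ g₀ t := by
  obtain ⟨σ, hσ⟩ := h
  have hchoice : ∀ γ, ∃ m, Dominated σ g₀ γ →
      MValid γ.1 m ∧ ∀ γ', CutterResp γ m γ' → Dominated σ g₀ γ' := by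
    intro γ
    by_cases hγ : Dominated σ g₀ γ
    · obtain ⟨m, hm⟩ := hγ.exists_choice hσ
      exact ⟨m, fun _ => hm⟩
    · exact ⟨.same [] [], fun h => absurd h hγ⟩
  choose f hf using hchoice
  refine ⟨fun n hist => f (hist (Fin.last n)), fun n play h0 hplay => ?_⟩
  have hdom : ∀ k ≤ n, Dominated σ g₀ (play k) := by
    intro k
    induction k with
    | zero =>
      intro _
      refine ⟨by simp [h0], 0, play, ⟨h0, by simp⟩, le_rfl, id, Embeds.refl _⟩
    | succ k ih =>
      intro hk
      exact (hf _ (ih (by omega))).2 _ (hplay k hk).2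
  exact ⟨(hf _ (hdom n le_rfl)).1, (hdom n le_rfl).gvalue_le hσ⟩

end MarkerCutter
end

section
/- Suppose in game state (D_k, χ_k, g_k) of the combinatorial Marker-Cutter game there is a directed cycle C with an isolated label a. If Marker chooses vertices v, w ∈ V(C) which gather a, and a occurs as a label on Ĉ₁, then the move of type (c) is not a legal move for restricted Cutter. -/
open scoped Classical

namespace MarkerCutter

/-- A cycle can be contracted to any nonempty sublist of its labels, keeping a fixed prefix. -/
theorem reflTransGen_contractStep_of_sublist (D : Config) {s w : Word} (h : s.Sublist w) :
    ∀ u : Word, u ++ s ≠ [] →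
      Relation.ReflTransGen ContractStep ((u ++ w) ::ₘ D) ((u ++ s) ::ₘ D) := by
  induction h with
  | slnil => exact fun u _ => .refl
  | @cons s l b h ih =>
    intro u hu
    refine .head ⟨D, u, l, b, rfl, .inr ⟨?_, rfl⟩⟩ (ih u hu)
    intro h0
    obtain ⟨rfl, rfl⟩ := List.append_eq_nil_iff.mp h0
    exact hu (by simpa using h)
  | @cons_cons s l b h ih =>
    intro u _
    simpa using ih (u ++ [b]) (by simp)

/-- A sublist of a linearisation of a cyclic word is a linearisation of a sublist of any other. -/
theorem IsRotationOf.exists_sublist {c w s : Word} (h : IsRotationOf c w) (hs : s.Sublist w) :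
    ∃ s', s'.Sublist c ∧ IsRotationOf s s' := by
  obtain ⟨n, rfl⟩ := h
  rw [List.rotate_eq_drop_append_take_mod, List.sublist_append_iff] at hs
  obtain ⟨s₁, s₂, rfl, h₁, h₂⟩ := hs
  refine ⟨s₂ ++ s₁, ?_, s₁.length, by rw [List.rotate_append_length_eq]⟩
  simpa using h₂.append h₁

theorem IsRotationOf.mem_iff {c w : Word} (h : IsRotationOf c w) {a : Label} :
    a ∈ w ↔ a ∈ c := by
  obtain ⟨n, rfl⟩ := h
  exact List.mem_rotate

theorem map_swap_eq_self {a b : Label} {w : Word} (ha : a ∉ w) (hb : b ∉ w) :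
    w.map (Equiv.swap a b) = w := by
  refine (List.map_congr_left fun x hx => ?_).trans w.map_id
  exact Equiv.swap_apply_of_ne_of_ne (fun h => ha (h ▸ hx)) (fun h => hb (h ▸ hx))

theorem mem_allLabels {D : Config} {a : Label} : a ∈ allLabels D ↔ ∃ w ∈ D, a ∈ w := by
  simp [allLabels]

theorem stmt13 (hist : Set GState) (γ : GState) (hγ : γ ∈ hist) (hproper : ProperState γ)
    (D₀ : Config) (c : Word) (a : Label)
    (hD : γ.1 = c ::ₘ D₀)
    (hiso : IsolatedLabel γ.1 a) (ha : a ∈ c)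
    (P P' : Word) (hsplit : IsRotationOf c (P ++ P'))
    (hgather : ¬ (a ∈ P ∧ a ∈ P'))
    (haP : a ∈ P)
    (γ' : GState) (hmove : RMoveC γ P P' γ') :
    ¬ RCLegal hist γ (MChoice.same P P') γ' := by
  rintro ⟨-, hlegal⟩
  refine hlegal γ hγ ?_
  obtain ⟨ℓ, hℓ, D, ⟨-, rfl, -⟩ | ⟨d, hd, hrot⟩, rfl⟩ := hmove
  · simp at haP
  have haP' : a ∉ P' := fun h => hgather ⟨haP, h⟩
  have had : a ∈ d := hrot.mem_iff.mp (by simp [haP])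
  have haD : ∀ w ∈ D, a ∉ w := by
    rw [IsolatedLabel, hd, Multiset.countP_cons_of_pos (p := fun w => a ∈ w) D had] at hiso
    exact Multiset.countP_eq_zero.mp (by omega)
  have hℓγ : ∀ w ∈ γ.1, ℓ ∉ w := fun w hw h => hℓ (mem_allLabels.mpr ⟨w, hw, h⟩)
  have hℓP' : ℓ ∉ P' := fun h =>
    hℓγ d (by simp [hd]) (hrot.mem_iff.mp (by simp [h]))
  obtain ⟨s, hsd, m, rfl⟩ := hrot.exists_sublist
    ((List.Sublist.refl P').append (List.singleton_sublist.mpr haP))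
  refine ⟨(((P' ++ [a]).rotate m) ::ₘ D, γ.2), ⟨le_rfl, ?_⟩, rfl,
    Equiv.swap a ℓ, (Equiv.swap a ℓ).bijective, ?_⟩
  · rw [hd]
    exact reflTransGen_contractStep_of_sublist D hsd [] (by simp [List.rotate_eq_nil_iff])
  · refine .cons ⟨m, ?_⟩ (Multiset.rel_refl_of_refl_on fun w hw => ⟨0, ?_⟩)
    · rw [List.map_append, map_swap_eq_self haP' hℓP']
      simp
    · rw [map_swap_eq_self (haD w hw) (hℓγ w (by simp [hd, hw])), List.rotate_zero]

end MarkerCutter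
end

section
/- Let γ_k = (D_k, χ_k, g_k) and γ_{k+1} = (D_{k+1}, χ_{k+1}, g_{k+1}) be consecutive game states in the combinatorial Marker-Cutter game with Cutter playing as restricted Cutter, and suppose the vertices v and w chosen by Marker lie in different components C and C' of D_k, so that restricted Cutter must respond with a move of type (d). Then: (1) p(γ_{k+1}) ≤ p(γ_k); and (2) if p(C, γ_k) ≥ 0, p(C', γ_k) ≥ 0, and both v and w are incident to two edges with different labels, then p(γ_{k+1}) = p(γ_k). -/
open scoped Classical

namespace MarkerCutter

theorem IsRotationOf.perm {c w : Word} (h : IsRotationOf c w) : w.Perm c := by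
  obtain ⟨n, rfl⟩ := h
  exact List.rotate_perm c n

theorem edgePot_rotate_one_succ (T : Multiset Label) (a : Label) (l : Word) {i : ℕ}
    (hi : i < l.length) :
    edgePot T (l ++ [a]) true i = edgePot T (a :: l) true (i + 1) := by
  have hg : ∀ k, k < l.length → (l ++ [a]).getD k 0 = l.getD k 0 := fun k hk => by
    simp [List.getD_eq_getElem?_getD, List.getElem?_append_left hk]
  have hlast : (l ++ [a]).getD l.length 0 = a := by simp
  have hs : ∀ k, (a :: l).getD (k + 1) 0 = l.getD k 0 := fun k => by simp
  have hz : (a :: l).getD 0 0 = a := by simp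
  unfold edgePot
  rw [hs, hg i hi]
  congr 2
  simp only [eq_iff_iff, List.length_append, List.length_cons, List.length_nil]
  constructor
  · rintro ⟨j, hj, hji, hjl, hadj⟩
    rcases Nat.lt_or_ge j l.length with h | h
    · exact ⟨j + 1, by omega, by omega, by rw [hs, ← hjl, hg j h], by simp; omega⟩
    · obtain rfl : j = l.length := by omega
      exact ⟨0, by omega, by omega, by rw [hz, ← hjl, hlast], by simp; omega⟩
  · rintro ⟨j, hj, hji, hjl, hadj⟩
    rcases j with _ | j
    · exact ⟨l.length, by omega, by omega, by rw [hlast, ← hjl, hz], by simp; omega⟩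
    · exact ⟨j, by omega, by omega, by rw [hg j (by omega), ← hjl, hs], by simp; omega⟩

theorem edgePot_rotate_one_last (T : Multiset Label) (a : Label) (l : Word) :
    edgePot T (l ++ [a]) true l.length = edgePot T (a :: l) true 0 := by
  have hg : ∀ k, k < l.length → (l ++ [a]).getD k 0 = l.getD k 0 := fun k hk => by
    simp [List.getD_eq_getElem?_getD, List.getElem?_append_left hk]
  have hlast : (l ++ [a]).getD l.length 0 = a := by simp
  have hs : ∀ k, (a :: l).getD (k + 1) 0 = l.getD k 0 := fun k => by simp
  have hz : (a :: l).getD 0 0 = a := by simp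
  unfold edgePot
  rw [hlast, hz]
  congr 2
  simp only [eq_iff_iff, List.length_append, List.length_cons, List.length_nil]
  constructor
  · rintro ⟨j, hj, hji, hjl, hadj⟩
    exact ⟨j + 1, by omega, by omega, by rw [hs, ← hjl, hg j (by omega)], by simp; omega⟩
  · rintro ⟨_ | j, hj, hji, hjl, hadj⟩
    · exact absurd rfl hji
    · exact ⟨j, by omega, by omega, by rw [hg j (by omega), ← hjl, hs], by simp; omega⟩

theorem wordPot_rotate_one (T : Multiset Label) (a : Label) (l : Word) :
    wordPot T (l ++ [a]) true = wordPot T (a :: l) true := by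
  simp only [wordPot, List.length_append, List.length_cons, List.length_nil, zero_add]
  rw [Finset.sum_range_succ, Finset.sum_range_succ' (edgePot T (a :: l) true),
    edgePot_rotate_one_last]
  congr 2
  exact Finset.sum_congr rfl fun i hi => edgePot_rotate_one_succ T a l (Finset.mem_range.1 hi)

theorem IsRotationOf.wordPot_eq {c w : Word} (h : IsRotationOf c w) (T : Multiset Label) :
    wordPot T w true = wordPot T c true := by
  obtain ⟨n, rfl⟩ := h
  induction n generalizing c with
  | zero => simp
  | succ n ih =>
    rcases c with _ | ⟨a, l⟩
    · simp
    · rw [List.rotate_cons_succ, ih, wordPot_rotate_one]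

theorem wordPot_path_le_cycle (T : Multiset Label) (w : Word) :
    wordPot T w false ≤ wordPot T w true := by
  unfold wordPot
  gcongr with i
  unfold edgePot
  split_ifs with h₁ h₂ h₃ h₄ <;> try norm_num
  obtain ⟨j, hj, hji, hjl, hadj⟩ := h₂
  exact h₃ ⟨j, hj, hji, hjl, by simp at hadj; omega⟩

theorem wordPot_path_eq_cycle (T : Multiset Label) {w : Word} (h : w.head? ≠ w.getLast?) :
    wordPot T w false = wordPot T w true := by
  have hne : w ≠ [] := by rintro rfl; exact h rfl
  have hpos := List.length_pos_iff.2 hne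
  have hends : w.getD 0 0 ≠ w.getD (w.length - 1) 0 := by
    intro he
    apply h
    rw [List.head?_eq_getElem?, List.getLast?_eq_getElem?]
    rw [List.getD_eq_getElem _ _ hpos, List.getD_eq_getElem _ _ (by omega)] at he
    rw [List.getElem?_eq_getElem hpos, List.getElem?_eq_getElem (by omega), he]
  unfold wordPot
  congr 1
  refine Finset.sum_congr rfl fun i _ => ?_
  unfold edgePot
  congr 2
  simp only [eq_iff_iff]
  refine exists_congr fun j => and_congr_right fun hj => and_congr_right fun hji =>
    and_congr_right fun hjl => ?_
  simp only [Bool.false_eq_true, false_and, or_false, true_and]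
  constructor
  · tauto
  · rintro (h | h | ⟨-, ⟨rfl, rfl⟩ | ⟨rfl, rfl⟩⟩)
    · exact .inl h
    · exact .inr h
    · exact absurd hjl.symm hends
    · exact absurd hjl hends

/-- Adding two copies of a fresh label does not affect the potential of edges with old labels. -/
theorem wordPot_fresh {T : Multiset Label} {ℓ : Label} (w : Word) (hw : ℓ ∉ w) (cyc : Bool) :
    wordPot (ℓ ::ₘ ℓ ::ₘ T) w cyc = wordPot T w cyc := by
  unfold wordPot
  congr 1
  refine Finset.sum_congr rfl fun i hi => ?_
  have hi := Finset.mem_range.1 hi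
  have hne : w.getD i 0 ≠ ℓ := by
    rw [List.getD_eq_getElem _ _ hi]
    exact fun h => hw (h ▸ List.getElem_mem hi)
  unfold edgePot
  rw [Multiset.count_cons_of_ne hne, Multiset.count_cons_of_ne hne]

theorem map_wordPot_fresh {T : Multiset Label} {ℓ : Label} {D₀ : Config}
    (hD : ∀ w ∈ D₀, ℓ ∉ w) :
    (D₀.map fun w => max (wordPot (ℓ ::ₘ ℓ ::ₘ T) w true) 0) =
      D₀.map fun w => max (wordPot T w true) 0 :=
  Multiset.map_congr rfl fun w hw => by rw [wordPot_fresh w (hD w hw)]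

theorem allLabels_amalgamate (D₀ : Config) (ℓ : Label) {c₁ c₂ w₁ w₂ : Word}
    (h₁ : IsRotationOf c₁ w₁) (h₂ : IsRotationOf c₂ w₂) :
    allLabels ((w₁ ++ [ℓ] ++ w₂ ++ [ℓ]) ::ₘ D₀) =
      ℓ ::ₘ ℓ ::ₘ allLabels (c₁ ::ₘ c₂ ::ₘ D₀) := by
  simp only [allLabels, Multiset.cons_bind, ← Multiset.coe_add, Multiset.coe_singleton,
    Multiset.coe_eq_coe.2 h₁.perm, Multiset.coe_eq_coe.2 h₂.perm]
  simp only [← Multiset.singleton_add]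
  abel

theorem gvalue_amalgamate {D D' : Config} {ℓ : Label} (g : ℕ) (hℓ : ℓ ∉ allLabels D)
    (hT : allLabels D' = ℓ ::ₘ ℓ ::ₘ allLabels D) : gvalue (D', g) = gvalue (D, g) + 1 := by
  simp [gvalue, hT, hℓ]

/-- The amalgamated cycle has the total potential of its two paths plus `3`. -/
theorem wordPot_amalgamate {T : Multiset Label} {ℓ : Label} {u v : Word} (hℓ : ℓ ∉ T)
    (hu : u ≠ []) (hv : v ≠ []) (hmu : ℓ ∉ u) (hmv : ℓ ∉ v) :
    wordPot (ℓ ::ₘ ℓ ::ₘ T) (u ++ [ℓ] ++ v ++ [ℓ]) true =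
      wordPot T u false + wordPot T v false + 3 := by
  have hlu := List.length_pos_iff.2 hu
  have hlv := List.length_pos_iff.2 hv
  rw [← wordPot_fresh u hmu, ← wordPot_fresh v hmv]
  have hlen : (u ++ [ℓ] ++ v ++ [ℓ]).length = u.length + 1 + v.length + 1 := by
    simp only [List.length_append, List.length_singleton]
  have hcount : (ℓ ::ₘ ℓ ::ₘ T).count ℓ = 2 := by simp [hℓ]
  generalize ℓ ::ₘ ℓ ::ₘ T = S at hcount ⊢
  have hU : ∀ i < u.length, (u ++ [ℓ] ++ v ++ [ℓ]).getD i 0 = u.getD i 0 := fun i hi => by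
    simp [List.getD_eq_getElem?_getD, List.getElem?_append_left hi]
  have hV : ∀ i < v.length,
      (u ++ [ℓ] ++ v ++ [ℓ]).getD (u.length + 1 + i) 0 = v.getD i 0 := fun i hi => by
    have : (u ++ [ℓ]).length ≤ u.length + 1 + i := by simp
    rw [List.append_assoc, List.getD_eq_getElem?_getD, List.getElem?_append_right this]
    simp [List.getElem?_append_left hi, List.getD_eq_getElem?_getD]
  have hmid : (u ++ [ℓ] ++ v ++ [ℓ]).getD u.length 0 = ℓ := by simp
  have hlast : (u ++ [ℓ] ++ v ++ [ℓ]).getD (u.length + 1 + v.length) 0 = ℓ := by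
    rw [show u.length + 1 + v.length = (u ++ [ℓ] ++ v).length by
      simp only [List.length_append, List.length_singleton]]
    simp only [List.getD_eq_getElem?_getD, List.getElem?_concat_length, Option.getD_some]
  have hUne : ∀ i < u.length, u.getD i 0 ≠ ℓ := fun i hi h => by
    rw [List.getD_eq_getElem _ _ hi] at h
    exact hmu (h ▸ List.getElem_mem hi)
  have hVne : ∀ i < v.length, v.getD i 0 ≠ ℓ := fun i hi h => by
    rw [List.getD_eq_getElem _ _ hi] at h
    exact hmv (h ▸ List.getElem_mem hi)
  generalize u ++ [ℓ] ++ v ++ [ℓ] = W at *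
  have hpos : ∀ j < W.length, j < u.length ∨ j = u.length ∨
      (∃ k < v.length, j = u.length + 1 + k) ∨ j = u.length + 1 + v.length := fun j hj => by
    by_cases h : j < u.length + 1
    · omega
    · by_cases h' : j = u.length + 1 + v.length
      · omega
      · exact .inr (.inr (.inl ⟨j - (u.length + 1), by omega, by omega⟩))
  have eU : ∀ i < u.length, edgePot S W true i = edgePot S u false i := fun i hi => by
    unfold edgePot
    rw [hU i hi]
    congr 2
    simp only [eq_iff_iff, Bool.false_eq_true, false_and, or_false, true_and]
    constructor
    · rintro ⟨j, hj, hji, hjl, hadj⟩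
      rcases hpos j hj with h | rfl | ⟨k, hk, rfl⟩ | rfl
      · exact ⟨j, h, hji, by rw [← hjl, hU j h], by omega⟩
      · exact absurd (hjl.symm.trans hmid) (hUne i hi)
      · omega
      · exact absurd (hjl.symm.trans hlast) (hUne i hi)
    · rintro ⟨j, hj, hji, hjl, hadj⟩
      exact ⟨j, by omega, hji, by rw [hU j hj, hjl], by omega⟩
  have eV : ∀ i < v.length,
      edgePot S W true (u.length + 1 + i) = edgePot S v false i := fun i hi => by
    unfold edgePot
    rw [hV i hi]
    congr 2
    simp only [eq_iff_iff, Bool.false_eq_true, false_and, or_false, true_and]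
    constructor
    · rintro ⟨j, hj, hji, hjl, hadj⟩
      rcases hpos j hj with h | rfl | ⟨k, hk, rfl⟩ | rfl
      · omega
      · exact absurd (hjl.symm.trans hmid) (hVne i hi)
      · exact ⟨k, hk, by omega, by rw [← hjl, hV k hk], by omega⟩
      · exact absurd (hjl.symm.trans hlast) (hVne i hi)
    · rintro ⟨j, hj, hji, hjl, hadj⟩
      exact ⟨u.length + 1 + j, by omega, by omega, by rw [hV j hj, hjl], by omega⟩
  have eℓ : ∀ i, (i = u.length ∨ i = u.length + 1 + v.length) →
      edgePot S W true i = 1 / 2 := fun i hi => by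
    have hWi : W.getD i 0 = ℓ := by rcases hi with rfl | rfl <;> assumption
    unfold edgePot
    rw [hWi, hcount, if_neg (by norm_num), if_neg]
    rintro ⟨j, hj, hji, hjl, hadj⟩
    simp only [true_and] at hadj
    rcases hpos j hj with h | rfl | ⟨k, hk, rfl⟩ | rfl
    · exact hUne j h ((hU j h).symm.trans hjl)
    · omega
    · exact hVne k hk ((hV k hk).symm.trans hjl)
    · omega
  simp only [wordPot]
  rw [hlen, Finset.sum_range_succ, Finset.sum_range_add, Finset.sum_range_succ,
    eℓ _ (.inl rfl), eℓ _ (.inr rfl),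
    Finset.sum_congr rfl fun i hi => eU i (Finset.mem_range.1 hi),
    Finset.sum_congr rfl fun i hi => eV i (Finset.mem_range.1 hi)]
  ring

theorem stmt16 (g₀ : ℕ) (hist : Set GState)
    (γ γ' : GState) (hγ : γ ∈ hist) (hproper : ProperState γ)
    (D₀ : Config) (c₁ c₂ w₁ w₂ : Word) (g : ℕ)
    (hγeq : γ = (c₁ ::ₘ c₂ ::ₘ D₀, g))
    (h₁ : IsRotationOf c₁ w₁) (h₂ : IsRotationOf c₂ w₂)
    (hne₁ : w₁ ≠ []) (hne₂ : w₂ ≠ [])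
    (ℓ : Label) (hℓ : ℓ ∉ allLabels γ.1)
    (hγ' : γ' = ((w₁ ++ [ℓ] ++ w₂ ++ [ℓ]) ::ₘ D₀, g))
    (hlegal : ∀ δ ∈ hist, ¬ IsEquivReductionOf γ' δ) :
    statePot g₀ γ' ≤ statePot g₀ γ ∧
    ((0 ≤ wordPot (allLabels γ.1) c₁ true ∧ 0 ≤ wordPot (allLabels γ.1) c₂ true ∧
      w₁.head? ≠ w₁.getLast? ∧ w₂.head? ≠ w₂.getLast?) →
      statePot g₀ γ' = statePot g₀ γ) := by
  subst hγeq hγ'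
  have hT := allLabels_amalgamate D₀ ℓ h₁ h₂
  have hv := gvalue_amalgamate g hℓ hT
  have hm₁ : ℓ ∉ w₁ := fun h => hℓ (by simp [allLabels, h₁.mem_iff.1 h])
  have hm₂ : ℓ ∉ w₂ := fun h => hℓ (by simp [allLabels, h₂.mem_iff.1 h])
  have hW := wordPot_amalgamate hℓ hne₁ hne₂ hm₁ hm₂
  have hrest := map_wordPot_fresh (T := allLabels (c₁ ::ₘ c₂ ::ₘ D₀)) (D₀ := D₀) fun w hw h => hℓ (by
    simp only [allLabels, Multiset.mem_bind, Multiset.mem_coe]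
    exact ⟨w, by simp [hw], h⟩)
  have e₁ := h₁.wordPot_eq (allLabels (c₁ ::ₘ c₂ ::ₘ D₀))
  have e₂ := h₂.wordPot_eq (allLabels (c₁ ::ₘ c₂ ::ₘ D₀))
  have le₁ := wordPot_path_le_cycle (allLabels (c₁ ::ₘ c₂ ::ₘ D₀)) w₁
  have le₂ := wordPot_path_le_cycle (allLabels (c₁ ::ₘ c₂ ::ₘ D₀)) w₂
  simp only [statePot, hv, hT, Multiset.map_cons, Multiset.sum_cons, hrest, hW]
  rw [← e₁, ← e₂]
  push_cast
  refine ⟨?_, ?_⟩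
  · have := le_max_left (wordPot (allLabels (c₁ ::ₘ c₂ ::ₘ D₀)) w₁ true) 0
    have := le_max_left (wordPot (allLabels (c₁ ::ₘ c₂ ::ₘ D₀)) w₂ true) 0
    have := le_max_right (wordPot (allLabels (c₁ ::ₘ c₂ ::ₘ D₀)) w₁ true) 0
    have := le_max_right (wordPot (allLabels (c₁ ::ₘ c₂ ::ₘ D₀)) w₂ true) 0
    have : max (wordPot (allLabels (c₁ ::ₘ c₂ ::ₘ D₀)) w₁ false +
        wordPot (allLabels (c₁ ::ₘ c₂ ::ₘ D₀)) w₂ false + 3) 0 ≤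
        max (wordPot (allLabels (c₁ ::ₘ c₂ ::ₘ D₀)) w₁ true) 0 +
        max (wordPot (allLabels (c₁ ::ₘ c₂ ::ₘ D₀)) w₂ true) 0 + 3 :=
      max_le (by linarith) (by linarith)
    linarith
  · rintro ⟨p₁, p₂, d₁, d₂⟩
    rw [wordPot_path_eq_cycle _ d₁, wordPot_path_eq_cycle _ d₂, max_eq_left p₁,
      max_eq_left p₂, max_eq_left (by linarith)]
    ring

end MarkerCutter
end

section
/- Let γ_k = (D_k, χ_k, g_k) and γ_{k+1} be consecutive game states in the combinatorial Marker-Cutter game with Cutter playing as restricted Cutter, where Marker chose vertices v, w on a common cycle C giving paths P, P' and cycles Ĉ₁ = P ∪ {f}, Ĉ₂ = P' ∪ {f'}, and restricted Cutter responded with a move of type (a). Then: (1) if p(P, γ_k) ≥ −1/2 and p(P', γ_k) ≥ −1/2, then p(γ_{k+1}) ≤ p(γ_k); and (2) if v and w gather every label that appears on C, then p(γ_{k+1}) ≥ p(γ_k). -/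
open scoped Classical

namespace MarkerCutter

/-- The edge at position `j` is incident on `w` to the edge at position `i` and has the same
label. -/
def Twin (w : Word) (cyc : Bool) (i j : ℕ) : Prop :=
  j ≠ i ∧ w.getD j 0 = w.getD i 0 ∧
    (j = i + 1 ∨ i = j + 1 ∨
      (cyc = true ∧ 2 ≤ w.length ∧ ((i = 0 ∧ j = w.length - 1) ∨ (j = 0 ∧ i = w.length - 1))))

lemma edgePot_eq (t : Multiset Label) (w : Word) (cyc : Bool) (i : ℕ) :
    edgePot t w cyc i =
      if t.count (w.getD i 0) = 1 then 3/2
      else if ∃ j < w.length, Twin w cyc i j then 3/4 else 1/2 := by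
  unfold edgePot
  congr 1
  exact if_congr Iff.rfl rfl rfl

lemma edgePot_le {t : Multiset Label} {w w' : Word} {b b' : Bool} {i i' : ℕ}
    (hlab : w.getD i 0 = w'.getD i' 0)
    (h : ∀ j < w.length, Twin w b i j → ∃ j' < w'.length, Twin w' b' i' j') :
    edgePot t w b i ≤ edgePot t w' b' i' := by
  rw [edgePot_eq, edgePot_eq, hlab]
  split_ifs with h₁ h₂ h₃ h₃
  · rfl
  · rfl
  · obtain ⟨j, hj, hT⟩ := h₂
    exact absurd (h j hj hT) h₃
  · norm_num
  · rfl

lemma getD_mem {w : Word} {i : ℕ} (hi : i < w.length) : w.getD i 0 ∈ w := by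
  rw [List.getD_eq_getElem _ _ hi]
  exact List.getElem_mem hi

lemma getD_append_add (u v : Word) (i : ℕ) : (u ++ v).getD (u.length + i) 0 = v.getD i 0 := by
  rw [List.getD_append_right _ _ _ _ (by omega)]
  congr 1
  omega

lemma wordPot_congr {t t' : Multiset Label} {w : Word} (cyc : Bool)
    (h : ∀ a ∈ w, t.count a = t'.count a) : wordPot t w cyc = wordPot t' w cyc := by
  unfold wordPot
  congr 1
  refine Finset.sum_congr rfl fun i hi => ?_
  rw [edgePot_eq, edgePot_eq, h _ (getD_mem (Finset.mem_range.mp hi))]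

lemma getD_rotate_one {w : Word} {i : ℕ} (hi : i < w.length) :
    (w.rotate 1).getD i 0 = w.getD ((i + 1) % w.length) 0 := by
  rw [List.getD_eq_getElem _ _ (by simpa using hi), List.getElem_rotate,
    List.getD_eq_getElem _ _ (Nat.mod_lt _ (by omega))]

lemma succ_mod_eq {i n : ℕ} (hi : i < n) : (i + 1) % n = if i + 1 = n then 0 else i + 1 := by
  split_ifs with h
  · rw [h, Nat.mod_self]
  · exact Nat.mod_eq_of_lt (by omega)

lemma twin_rotate_one {w : Word} {i j : ℕ} (hi : i < w.length) (hj : j < w.length) :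
    Twin (w.rotate 1) true i j ↔ Twin w true ((i + 1) % w.length) ((j + 1) % w.length) := by
  unfold Twin
  rw [getD_rotate_one hi, getD_rotate_one hj, List.length_rotate, succ_mod_eq hi, succ_mod_eq hj]
  generalize w.getD _ 0 = x
  generalize w.getD _ 0 = y
  simp only [true_and]
  rw [and_left_comm, and_left_comm (b := x = y)]
  refine and_congr_right fun _ => ?_
  split_ifs <;> grind

lemma edgePot_rotate_one (t : Multiset Label) {w : Word} {i : ℕ} (hi : i < w.length) :
    edgePot t (w.rotate 1) true i = edgePot t w true ((i + 1) % w.length) := by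
  refine le_antisymm (edgePot_le (getD_rotate_one hi) fun j hj hT => ?_)
    (edgePot_le (getD_rotate_one hi).symm fun j hj hT => ?_)
  · rw [List.length_rotate] at hj
    exact ⟨_, Nat.mod_lt _ (by omega), (twin_rotate_one hi hj).mp hT⟩
  · obtain ⟨k, hk, rfl⟩ : ∃ k < w.length, (k + 1) % w.length = j := by
      rcases Nat.eq_zero_or_pos j with rfl | h
      · exact ⟨w.length - 1, by omega, by rw [Nat.sub_add_cancel (by omega), Nat.mod_self]⟩
      · exact ⟨j - 1, by omega, by rw [Nat.sub_add_cancel h, Nat.mod_eq_of_lt hj]⟩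
    exact ⟨k, by simpa using hk, (twin_rotate_one hi hk).mpr hT⟩

lemma wordPot_rotate_one_s17 (t : Multiset Label) (w : Word) :
    wordPot t (w.rotate 1) true = wordPot t w true := by
  unfold wordPot
  rw [List.length_rotate]
  congr 1
  rw [Finset.sum_congr rfl fun i hi => edgePot_rotate_one t (Finset.mem_range.mp hi)]
  cases h : w.length with
  | zero => rfl
  | succ n =>
    rw [Finset.sum_range_succ, Finset.sum_range_succ', Nat.mod_self]
    congr 1
    exact Finset.sum_congr rfl fun i hi => by
      rw [Nat.mod_eq_of_lt (by have := Finset.mem_range.mp hi; omega)]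

lemma wordPot_rotate (t : Multiset Label) (w : Word) (n : ℕ) :
    wordPot t (w.rotate n) true = wordPot t w true := by
  induction n with
  | zero => rw [List.rotate_zero]
  | succ n ih => rw [← List.rotate_rotate, wordPot_rotate_one_s17, ih]

/-- Closing up a path by an edge with a label that is new to the path but not uniquely
appearing increases the potential by `1/2`. -/
lemma wordPot_append_singleton {t : Multiset Label} {P : Word} {a : Label}
    (ha : a ∉ P) (hc : t.count a ≠ 1) :
    wordPot t (P ++ [a]) true = wordPot t P false + 1/2 := by
  have hlab : ∀ i < P.length, (P ++ [a]).getD i 0 = P.getD i 0 := fun i hi =>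
    List.getD_append _ _ _ _ hi
  have hlast : (P ++ [a]).getD P.length 0 = a := by simp
  have hne : ∀ i < P.length, P.getD i 0 ≠ a := fun i hi h => ha (h ▸ getD_mem hi)
  have hP : ∀ i < P.length, edgePot t (P ++ [a]) true i = edgePot t P false i := by
    intro i hi
    refine le_antisymm (edgePot_le (hlab i hi) ?_) (edgePot_le (hlab i hi).symm ?_)
    · rintro j hj ⟨h₁, h₂, h₃⟩
      rw [List.length_append, List.length_singleton] at hj h₃
      rw [hlab i hi] at h₂
      have hjP : j < P.length := by
        by_contra hcon
        obtain rfl : j = P.length := by omega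
        exact hne i hi (h₂.symm.trans hlast)
      rw [hlab j hjP] at h₂
      exact ⟨j, hjP, h₁, h₂, by omega⟩
    · rintro j hj ⟨h₁, h₂, h₃⟩
      refine ⟨j, by simp; omega, h₁, by rw [hlab i hi, hlab j hj, h₂], ?_⟩
      simp only [Bool.false_eq_true, false_and, or_false] at h₃
      tauto
  have hl : edgePot t (P ++ [a]) true P.length = 1/2 := by
    rw [edgePot_eq, hlast, if_neg hc, if_neg]
    rintro ⟨j, hj, h₁, h₂, -⟩
    rw [List.length_append, List.length_singleton] at hj
    have hjP : j < P.length := by omega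
    rw [hlab j hjP, hlast] at h₂
    exact hne j hjP h₂
  unfold wordPot
  rw [List.length_append, List.length_singleton, Finset.sum_range_succ, hl,
    Finset.sum_congr rfl fun i hi => hP i (Finset.mem_range.mp hi)]
  ring

lemma wordPot_append (t : Multiset Label) (u v : Word) (cyc : Bool) :
    wordPot t (u ++ v) cyc = -2 + (∑ i ∈ Finset.range u.length, edgePot t (u ++ v) cyc i +
      ∑ i ∈ Finset.range v.length, edgePot t (u ++ v) cyc (u.length + i)) := by
  rw [wordPot, List.length_append, Finset.sum_range_add]

lemma edgePot_le_append_left (t : Multiset Label) (u v : Word) (cyc : Bool) {i : ℕ}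
    (hi : i < u.length) : edgePot t u false i ≤ edgePot t (u ++ v) cyc i := by
  refine edgePot_le (List.getD_append _ _ _ _ hi).symm ?_
  rintro j hj ⟨h₁, h₂, h₃⟩
  simp only [Bool.false_eq_true, false_and, or_false] at h₃
  exact ⟨j, by simp; omega, h₁, by
    rw [List.getD_append _ _ _ _ hi, List.getD_append _ _ _ _ hj, h₂], by tauto⟩

lemma edgePot_le_append_right (t : Multiset Label) (u v : Word) (cyc : Bool) (i : ℕ) :
    edgePot t v false i ≤ edgePot t (u ++ v) cyc (u.length + i) := by
  refine edgePot_le (getD_append_add u v i).symm ?_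
  rintro j hj ⟨h₁, h₂, h₃⟩
  simp only [Bool.false_eq_true, false_and, or_false] at h₃
  exact ⟨u.length + j, by simp; omega, by omega, by
    rw [getD_append_add, getD_append_add, h₂], by omega⟩

lemma wordPot_add_le (t : Multiset Label) (u v : Word) (cyc : Bool) :
    wordPot t u false + wordPot t v false + 2 ≤ wordPot t (u ++ v) cyc := by
  rw [wordPot_append, wordPot, wordPot]
  have h₁ := Finset.sum_le_sum fun i hi =>
    edgePot_le_append_left t u v cyc (Finset.mem_range.mp hi)
  have h₂ := Finset.sum_le_sum fun i (_ : i ∈ Finset.range v.length) =>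
    edgePot_le_append_right t u v cyc i
  linarith

/-- If two nonempty paths share no label, joining them creates no new incidences between
edges of equal label. -/
lemma wordPot_append_le {t : Multiset Label} {u v : Word} (cyc : Bool) (hu : u ≠ [])
    (hv : v ≠ []) (hd : ∀ a ∈ u, a ∉ v) :
    wordPot t (u ++ v) cyc ≤ wordPot t u false + wordPot t v false + 2 := by
  have hu' := List.length_pos_iff.mpr hu
  have hv' := List.length_pos_iff.mpr hv
  have h₁ : ∀ i ∈ Finset.range u.length,
      edgePot t (u ++ v) cyc i ≤ edgePot t u false i := by
    intro i hi
    rw [Finset.mem_range] at hi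
    refine edgePot_le (List.getD_append _ _ _ _ hi) ?_
    rintro j hj ⟨h₁, h₂, h₃⟩
    rw [List.length_append] at hj h₃
    rw [List.getD_append _ _ _ _ hi] at h₂
    have hju : j < u.length := by
      by_contra hcon
      obtain ⟨k, rfl⟩ := Nat.exists_eq_add_of_le (not_lt.mp hcon)
      rw [getD_append_add] at h₂
      exact hd _ (getD_mem hi) (h₂ ▸ getD_mem (by omega))
    rw [List.getD_append _ _ _ _ hju] at h₂
    exact ⟨j, hju, h₁, h₂, by omega⟩
  have h₂ : ∀ i ∈ Finset.range v.length,
      edgePot t (u ++ v) cyc (u.length + i) ≤ edgePot t v false i := by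
    intro i hi
    rw [Finset.mem_range] at hi
    refine edgePot_le (getD_append_add u v i) ?_
    rintro j hj ⟨h₁, h₂, h₃⟩
    rw [List.length_append] at hj h₃
    rw [getD_append_add] at h₂
    have hju : u.length ≤ j := by
      by_contra hcon
      rw [List.getD_append _ _ _ _ (not_le.mp hcon)] at h₂
      exact hd _ (getD_mem (not_le.mp hcon)) (h₂ ▸ getD_mem hi)
    obtain ⟨k, rfl⟩ := Nat.exists_eq_add_of_le hju
    rw [getD_append_add] at h₂
    exact ⟨k, by omega, by omega, h₂, by omega⟩
  rw [wordPot_append, wordPot, wordPot]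
  linarith [Finset.sum_le_sum h₁, Finset.sum_le_sum h₂]

lemma edgePot_le_add (t : Multiset Label) (w : Word) (i : ℕ) :
    edgePot t w true i ≤ edgePot t w false i +
      ((if i = 0 then 1/4 else 0) + (if i = w.length - 1 then 1/4 else 0)) := by
  by_cases h : i = 0 ∨ i = w.length - 1
  · have h₁ : (1/4 : ℚ) ≤ (if i = 0 then 1/4 else 0) + (if i = w.length - 1 then 1/4 else 0) := by
      rcases h with h | h <;> rw [if_pos h] <;> split_ifs <;> norm_num
    have h₂ : edgePot t w true i ≤ edgePot t w false i + 1/4 := by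
      rw [edgePot_eq, edgePot_eq]
      split_ifs <;> norm_num
    linarith
  · have h₁ : edgePot t w true i ≤ edgePot t w false i := by
      refine edgePot_le rfl ?_
      rintro j hj ⟨h₁, h₂, h₃⟩
      exact ⟨j, hj, h₁, h₂, by omega⟩
    push Not at h
    simpa [h] using h₁

/-- Cutting a cycle open at a vertex loses at most `1/2` of its potential. -/
lemma wordPot_cyc_le (t : Multiset Label) (w : Word) :
    wordPot t w true ≤ wordPot t w false + 1/2 := by
  rcases Nat.eq_zero_or_pos w.length with h | h
  · simp [wordPot, h]
  · have hs := Finset.sum_le_sum fun i (_ : i ∈ Finset.range w.length) => edgePot_le_add t w i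
    rw [Finset.sum_add_distrib, Finset.sum_add_distrib, Finset.sum_ite_eq', Finset.sum_ite_eq',
      if_pos (Finset.mem_range.mpr h), if_pos (Finset.mem_range.mpr (by omega))] at hs
    unfold wordPot
    linarith

theorem stmt17 (g₀ : ℕ) (hist : Set GState)
    (γ γ' : GState) (hγ : γ ∈ hist) (hproper : ProperState γ)
    (D₀ : Config) (c P P' : Word) (g : ℕ) (hγeq : γ = (c ::ₘ D₀, g))
    (hsplit : IsRotationOf c (P ++ P')) (hg : 1 ≤ g)
    (ℓ : Label) (hℓ : ℓ ∉ allLabels γ.1)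
    (hγ' : γ' = ((P ++ [ℓ]) ::ₘ (P' ++ [ℓ]) ::ₘ D₀, g - 1))
    (hlegal : ∀ δ ∈ hist, ¬ IsEquivReductionOf γ' δ) :
    ((-(1/2 : ℚ) ≤ wordPot (allLabels γ.1) P false ∧
      -(1/2 : ℚ) ≤ wordPot (allLabels γ.1) P' false) →
      statePot g₀ γ' ≤ statePot g₀ γ) ∧
    ((∀ a ∈ c, ¬ (a ∈ P ∧ a ∈ P')) → statePot g₀ γ ≤ statePot g₀ γ') := by
  obtain ⟨n, hn⟩ := hsplit
  subst hγeq hγ'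
  have hperm : (c : Multiset Label) = (P : Multiset Label) + P' := by
    rw [Multiset.coe_add, hn, Multiset.coe_eq_coe]
    exact (List.rotate_perm c n).symm
  have hlabels : allLabels ((P ++ [ℓ]) ::ₘ (P' ++ [ℓ]) ::ₘ D₀) =
      ℓ ::ₘ ℓ ::ₘ allLabels (c ::ₘ D₀) := by
    simp only [allLabels, Multiset.cons_bind, hperm, ← Multiset.coe_add, Multiset.coe_singleton]
    simp only [← Multiset.singleton_add]
    abel
  have hval : gvalue ((P ++ [ℓ]) ::ₘ (P' ++ [ℓ]) ::ₘ D₀, g - 1) =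
      gvalue (c ::ₘ D₀, g) + 1 := by
    simp only [gvalue, hlabels]
    rw [Multiset.toFinset_cons, Multiset.toFinset_cons, Finset.insert_idem,
      Finset.card_insert_of_notMem (by simpa using hℓ)]
  have hmem : ∀ w ∈ c ::ₘ D₀, ∀ a ∈ w, a ∈ allLabels (c ::ₘ D₀) := fun w hw a ha =>
    Multiset.mem_bind.mpr ⟨w, hw, ha⟩
  have hmemc : ∀ a, a ∈ P ∨ a ∈ P' → a ∈ c := fun a ha => by
    rw [← Multiset.mem_coe, hperm]
    simpa using ha
  simp only [statePot, hval, hlabels, Multiset.map_cons, Multiset.sum_cons]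
  simp only at hℓ
  set T := allLabels (c ::ₘ D₀) with hT
  have hcount : ∀ a ∈ T, (ℓ ::ₘ ℓ ::ₘ T).count a = T.count a := fun a ha => by
    have hne : a ≠ ℓ := fun h => hℓ (h ▸ ha)
    rw [Multiset.count_cons_of_ne hne, Multiset.count_cons_of_ne hne]
  have hcℓ : (ℓ ::ₘ ℓ ::ₘ T).count ℓ ≠ 1 := by
    simp
  have hrest : D₀.map (fun w => max (wordPot (ℓ ::ₘ ℓ ::ₘ T) w true) 0) =
      D₀.map (fun w => max (wordPot T w true) 0) :=
    Multiset.map_congr rfl fun w hw => by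
      rw [wordPot_congr true fun a ha => hcount a (hmem w (Multiset.mem_cons_of_mem hw) a ha)]
  have hcT : ∀ a ∈ c, a ∈ T := hmem c (Multiset.mem_cons_self _ _)
  have hpot : ∀ Q : Word, (∀ a ∈ Q, a ∈ c) →
      wordPot (ℓ ::ₘ ℓ ::ₘ T) (Q ++ [ℓ]) true = wordPot T Q false + 1/2 := fun Q hQ => by
    rw [wordPot_append_singleton (fun h => hℓ (hcT _ (hQ _ h))) hcℓ,
      wordPot_congr false fun a ha => hcount a (hcT a (hQ a ha))]
  have hrot : wordPot T c true = wordPot T (P ++ P') true := by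
    rw [hn, wordPot_rotate]
  rw [hrest, hpot P fun a ha => hmemc a (.inl ha), hpot P' fun a ha => hmemc a (.inr ha), hrot]
  push_cast [Nat.cast_sub hg]
  constructor
  · rintro ⟨h₁, h₂⟩
    rw [max_eq_left (by linarith), max_eq_left (by linarith)]
    linarith [wordPot_add_le T P P' true, le_max_left (wordPot T (P ++ P') true) 0]
  · intro hd
    have h₁ := le_max_left (wordPot T P false + 1/2) 0
    have h₂ := le_max_left (wordPot T P' false + 1/2) 0
    have h₃ := le_max_right (wordPot T P false + 1/2) 0
    have h₄ := le_max_right (wordPot T P' false + 1/2) 0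
    suffices h : max (wordPot T (P ++ P') true) 0 ≤
        max (wordPot T P false + 1/2) 0 + max (wordPot T P' false + 1/2) 0 + 1 by linarith
    refine max_le ?_ (by linarith)
    rcases eq_or_ne P [] with rfl | hP
    · rw [List.nil_append]
      linarith [wordPot_cyc_le T P']
    rcases eq_or_ne P' [] with rfl | hP'
    · rw [List.append_nil]
      linarith [wordPot_cyc_le T P]
    linarith [wordPot_append_le (t := T) true hP hP'
      fun a ha ha' => hd a (hmemc a (.inl ha)) ⟨ha, ha'⟩]

end MarkerCutter
end
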